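/- Let f : ℝ² → ℝ² be a homeomorphism. Then f is topologically conjugate to a linear hyperbolic automorphism (i.e. there exist λ > 1 and a homeomorphism h : ℝ² → ℝ² with h ∘ f = L_λ ∘ h, where L_λ(x,y) = (λ·x, λ⁻¹·y)) if and only if f has a fixed point p and admits a Lyapunov metric function U satisfying the both-signs condition and condition HP, such that f has no singularities (with respect to U) and every connected component of ℝ² \ (Wˢ(p) ∪ Wᵘ(p)) is f-invariant. -/

import Mathlib

/-- First difference of `U` along the dynamics of `f`:
`V(x,y) = U(f(x),f(y)) − U(x,y)`. -/
def Vd (f : Equiv.Perm (ℝ × ℝ)) (U : ℝ × ℝ → ℝ × ℝ → ℝ) (x y : ℝ × ℝ) : ℝ :=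
  U (f x) (f y) - U x y

/-- Second difference of `U` along the dynamics of `f`:
`W(x,y) = U(f²(x),f²(y)) − 2·U(f(x),f(y)) + U(x,y)`. -/
def Wd (f : Equiv.Perm (ℝ × ℝ)) (U : ℝ × ℝ → ℝ × ℝ → ℝ) (x y : ℝ × ℝ) : ℝ :=
  U (f (f x)) (f (f y)) - 2 * U (f x) (f y) + U x y

/-- `U` is a Lyapunov metric function for `f`: a continuous metric on the plane
inducing the same topology as the Euclidean one, whose second difference along
`f` is strictly positive off the diagonal. -/
def IsLyapunovMetric (f : Equiv.Perm (ℝ × ℝ)) (U : ℝ × ℝ → ℝ × ℝ → ℝ) : Prop :=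
  Continuous (fun z : (ℝ × ℝ) × (ℝ × ℝ) => U z.1 z.2) ∧
  (∀ x y, 0 ≤ U x y) ∧ (∀ x y, U x y = U y x) ∧
  (∀ x y, U x y = 0 ↔ x = y) ∧
  (∀ x y z, U x z ≤ U x y + U y z) ∧
  (∀ x : ℝ × ℝ, ∀ ε > (0:ℝ), ∃ δ > (0:ℝ), ∀ y, dist x y < δ → U x y < ε) ∧
  (∀ x : ℝ × ℝ, ∀ ε > (0:ℝ), ∃ δ > (0:ℝ), ∀ y, U x y < δ → dist x y < ε) ∧
  (∀ x y : ℝ × ℝ, x ≠ y → 0 < Wd f U x y)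

/-- `B_k(x)`: the connected component containing `x` of `{w : U(x,w) ≤ k}`. -/
def Bk (U : ℝ × ℝ → ℝ × ℝ → ℝ) (k : ℝ) (x : ℝ × ℝ) : Set (ℝ × ℝ) :=
  connectedComponentIn {w : ℝ × ℝ | U x w ≤ k} x

/-- The both-signs condition: on the boundary of every `B_k(x)` the first
difference takes both a positive and a negative value. -/
def BothSigns (f : Equiv.Perm (ℝ × ℝ)) (U : ℝ × ℝ → ℝ × ℝ → ℝ) : Prop :=
  ∀ x : ℝ × ℝ, ∀ k > (0:ℝ),
    (∃ y ∈ frontier (Bk U k x), 0 < Vd f U x y) ∧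
    (∃ z ∈ frontier (Bk U k x), Vd f U x z < 0)

/-- The `k`-stable set of `x`. -/
def Sk (f : Equiv.Perm (ℝ × ℝ)) (U : ℝ × ℝ → ℝ × ℝ → ℝ) (k : ℝ)
    (x : ℝ × ℝ) : Set (ℝ × ℝ) :=
  {y | ∀ n : ℤ, 0 ≤ n → U ((f ^ n) x) ((f ^ n) y) ≤ k}

/-- The `k`-unstable set of `x`. -/
def Uk (f : Equiv.Perm (ℝ × ℝ)) (U : ℝ × ℝ → ℝ × ℝ → ℝ) (k : ℝ)
    (x : ℝ × ℝ) : Set (ℝ × ℝ) :=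
  {y | ∀ n : ℤ, n ≤ 0 → U ((f ^ n) x) ((f ^ n) y) ≤ k}

/-- `C_k(x)`: the connected component of `S_k(x)` containing `x`. -/
def Ck (f : Equiv.Perm (ℝ × ℝ)) (U : ℝ × ℝ → ℝ × ℝ → ℝ) (k : ℝ)
    (x : ℝ × ℝ) : Set (ℝ × ℝ) :=
  connectedComponentIn (Sk f U k x) x

/-- `D_k(x)`: the connected component of `U_k(x)` containing `x`. -/
def Dk (f : Equiv.Perm (ℝ × ℝ)) (U : ℝ × ℝ → ℝ × ℝ → ℝ) (k : ℝ)
    (x : ℝ × ℝ) : Set (ℝ × ℝ) :=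
  connectedComponentIn (Uk f U k x) x

/-- The global stable set of `x`. -/
def Ws (f : Equiv.Perm (ℝ × ℝ)) (U : ℝ × ℝ → ℝ × ℝ → ℝ)
    (x : ℝ × ℝ) : Set (ℝ × ℝ) :=
  {y | ∃ K > (0:ℝ), ∀ n : ℤ, 0 ≤ n → U ((f ^ n) x) ((f ^ n) y) ≤ K}

/-- The global unstable set of `x`. -/
def Wu (f : Equiv.Perm (ℝ × ℝ)) (U : ℝ × ℝ → ℝ × ℝ → ℝ)
    (x : ℝ × ℝ) : Set (ℝ × ℝ) :=
  {y | ∃ K > (0:ℝ), ∀ n : ℤ, n ≤ 0 → U ((f ^ n) x) ((f ^ n) y) ≤ K}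

/-- Condition HP: for every compact set `C`, the quotient
`|V(x,y) − V(x,z)| / W(x,y)` tends to `0` as `‖x‖ → ∞`, uniformly in `y,z ∈ C`. -/
def CondHP (f : Equiv.Perm (ℝ × ℝ)) (U : ℝ × ℝ → ℝ × ℝ → ℝ) : Prop :=
  ∀ C : Set (ℝ × ℝ), IsCompact C → ∀ ε > (0:ℝ), ∃ R > (0:ℝ),
    ∀ x : ℝ × ℝ, R < ‖x‖ → ∀ y ∈ C, ∀ z ∈ C,
      |Vd f U x y - Vd f U x z| / Wd f U x y < ε

/-- `p` has local product structure: there are a homeomorphism `h` of `ℝ²` onto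
an open subset of `ℝ²` containing `p` and `k > 0` carrying vertical lines onto
local stable components and horizontal lines onto local unstable components. -/
def HasLocalProductStructure (f : Equiv.Perm (ℝ × ℝ))
    (U : ℝ × ℝ → ℝ × ℝ → ℝ) (p : ℝ × ℝ) : Prop :=
  ∃ (h : ℝ × ℝ → ℝ × ℝ) (k : ℝ), 0 < k ∧
    Continuous h ∧ Function.Injective h ∧ IsOpenMap h ∧
    p ∈ Set.range h ∧
    ∀ a b : ℝ,
      h '' {q : ℝ × ℝ | q.1 = a} = Ck f U k (h (a, b)) ∩ Set.range h ∧
      h '' {q : ℝ × ℝ | q.2 = b} = Dk f U k (h (a, b)) ∩ Set.range h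

/-- `f` has no singularities: every point has local product structure. -/
def NoSingularities (f : Equiv.Perm (ℝ × ℝ))
    (U : ℝ × ℝ → ℝ × ℝ → ℝ) : Prop :=
  ∀ p : ℝ × ℝ, HasLocalProductStructure f U p

/-- Every connected component (quadrant) of the complement of
`Wˢ(p) ∪ Wᵘ(p)` is `f`-invariant. -/
def QuadrantsInvariant (f : Equiv.Perm (ℝ × ℝ))
    (U : ℝ × ℝ → ℝ × ℝ → ℝ) (p : ℝ × ℝ) : Prop :=
  ∀ q : ℝ × ℝ, q ∉ Ws f U p ∪ Wu f U p →
    (f : ℝ × ℝ → ℝ × ℝ) '' connectedComponentIn (Ws f U p ∪ Wu f U p)ᶜ q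
      = connectedComponentIn (Ws f U p ∪ Wu f U p)ᶜ q


section Helpers
open Filter Topology Set


/-- Abstract hyperbolic data: two transverse closed equivalence relations
(stable and unstable) with local product charts and bounded brackets. -/
structure HypData (g : ℝ × ℝ ≃ₜ ℝ × ℝ) (p : ℝ × ℝ)
    (s u : ℝ × ℝ → ℝ × ℝ → Prop) : Prop where
  sE : Equivalence s
  uE : Equivalence u
  sC : IsClosed {q : (ℝ × ℝ) × (ℝ × ℝ) | s q.1 q.2}
  uC : IsClosed {q : (ℝ × ℝ) × (ℝ × ℝ) | u q.1 q.2}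
  sg : ∀ x y, s (g x) (g y) ↔ s x y
  ug : ∀ x y, u (g x) (g y) ↔ u x y
  su : ∀ x y, s x y → u x y → x = y
  bd : ∀ C : Set (ℝ × ℝ), IsCompact C → ∃ R : ℝ, ∀ x, (∃ y ∈ C, s x y) → (∃ z ∈ C, u x z) → ‖x‖ ≤ R
  ch : ∀ w, ∃ h : ℝ × ℝ → ℝ × ℝ, IsOpenEmbedding h ∧ w ∈ range h ∧
    (∀ a b b', s (h (a, b)) (h (a, b'))) ∧ (∀ a a' b, u (h (a, b)) (h (a', b)))
  gp : g p = p
  sconv : ∀ x, s x p → Tendsto (fun n : ℕ => g^[n] x) atTop (𝓝 p)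
  uconv : ∀ x, u x p → Tendsto (fun n : ℕ => g.symm^[n] x) atTop (𝓝 p)
  sstab : ∀ N ∈ 𝓝 p, ∃ M ∈ 𝓝 p, ∀ x ∈ M, s x p → ∀ n : ℕ, g^[n] x ∈ N
  ustab : ∀ N ∈ 𝓝 p, ∃ M ∈ 𝓝 p, ∀ x ∈ M, u x p → ∀ n : ℕ, g.symm^[n] x ∈ N

namespace HypData
variable {g : ℝ × ℝ ≃ₜ ℝ × ℝ} {p : ℝ × ℝ} {s u : ℝ × ℝ → ℝ × ℝ → Prop}

theorem swap (H : HypData g p s u) : HypData g.symm p u s where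
  sE := H.uE
  uE := H.sE
  sC := H.uC
  uC := H.sC
  sg x y := by rw [← H.ug]; simp
  ug x y := by rw [← H.sg]; simp
  su x y h1 h2 := H.su x y h2 h1
  bd C hC := by
    obtain ⟨R, hR⟩ := H.bd C hC
    exact ⟨R, fun x h1 h2 => hR x h2 h1⟩
  ch w := by
    obtain ⟨h, h1, h2, h3, h4⟩ := H.ch w
    refine ⟨fun q => h q.swap, ?_, ?_, ?_, ?_⟩
    · exact h1.comp (Homeomorph.prodComm ℝ ℝ).isOpenEmbedding
    · obtain ⟨q, rfl⟩ := h2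
      exact ⟨q.swap, by simp⟩
    · intro a b b'; exact h4 _ _ _
    · intro a a' b; exact h3 _ _ _
  gp := by rw [Homeomorph.symm_apply_eq, H.gp]
  sconv := H.uconv
  uconv := by simpa using H.sconv
  sstab := H.ustab
  ustab := by simpa using H.sstab

/-- The pairs for which the bracket exists. -/
def RR (s u : ℝ × ℝ → ℝ × ℝ → Prop) : Set ((ℝ × ℝ) × (ℝ × ℝ)) :=
  {q | ∃ w, s w q.1 ∧ u w q.2}

theorem uniq (H : HypData g p s u) {y z w w' : ℝ × ℝ} (h1 : s w y) (h2 : u w z)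
    (h3 : s w' y) (h4 : u w' z) : w = w' :=
  H.su _ _ (H.sE.trans h1 (H.sE.symm h3)) (H.uE.trans h2 (H.uE.symm h4))

/-- Sequential compactness of brackets. -/
theorem bracket_subseq (H : HypData g p s u) {y z w : ℕ → ℝ × ℝ} {y0 z0 : ℝ × ℝ}
    (hy : Tendsto y atTop (𝓝 y0)) (hz : Tendsto z atTop (𝓝 z0))
    (hs : ∀ n, s (w n) (y n)) (hu : ∀ n, u (w n) (z n)) :
    ∃ w0, s w0 y0 ∧ u w0 z0 ∧ ∃ φ : ℕ → ℕ, StrictMono φ ∧ Tendsto (w ∘ φ) atTop (𝓝 w0) := by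
  obtain ⟨R, hR⟩ := H.bd _ (hy.isCompact_insert_range.union hz.isCompact_insert_range)
  have hw : ∀ n, w n ∈ Metric.closedBall (0 : ℝ × ℝ) R := by
    intro n
    rw [mem_closedBall_zero_iff]
    exact hR _ ⟨y n, Or.inl (Or.inr ⟨n, rfl⟩), hs n⟩ ⟨z n, Or.inr (Or.inr ⟨n, rfl⟩), hu n⟩
  obtain ⟨w0, -, φ, hφ, hlim⟩ := (isCompact_closedBall (0 : ℝ × ℝ) R).tendsto_subseq hw
  refine ⟨w0, ?_, ?_, φ, hφ, hlim⟩
  · exact H.sC.mem_of_tendsto (hlim.prodMk_nhds (hy.comp hφ.tendsto_atTop))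
      (Eventually.of_forall fun n => hs _)
  · exact H.uC.mem_of_tendsto (hlim.prodMk_nhds (hz.comp hφ.tendsto_atTop))
      (Eventually.of_forall fun n => hu _)

theorem isClosed_RR (H : HypData g p s u) : IsClosed (RR s u) := by
  apply IsSeqClosed.isClosed
  intro q q0 hq hlim
  choose w h1 h2 using hq
  obtain ⟨w0, a, b, -⟩ := H.bracket_subseq
    ((continuous_fst.tendsto q0).comp hlim) ((continuous_snd.tendsto q0).comp hlim) h1 h2
  exact ⟨w0, a, b⟩

open Classical in
/-- The bracket. -/
noncomputable def br (s u : ℝ × ℝ → ℝ × ℝ → Prop) (q : (ℝ × ℝ) × (ℝ × ℝ)) : ℝ × ℝ :=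
  if h : ∃ w, s w q.1 ∧ u w q.2 then h.choose else 0

theorem br_spec {q : (ℝ × ℝ) × (ℝ × ℝ)} (hq : q ∈ RR s u) :
    s (br s u q) q.1 ∧ u (br s u q) q.2 := by
  have h : ∃ w, s w q.1 ∧ u w q.2 := hq
  rw [br, dif_pos h]
  exact h.choose_spec

theorem continuousOn_br (H : HypData g p s u) : ContinuousOn (br s u) (RR s u) := by
  rw [continuousOn_iff_continuous_domRestrict, continuous_iff_seqContinuous]
  intro q q0 hlim
  apply tendsto_of_subseq_tendsto
  intro ns hns
  have hlim' := (continuous_subtype_val.tendsto q0).comp (hlim.comp hns)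
  obtain ⟨w0, a, b, φ, -, hφ⟩ := H.bracket_subseq (w := fun n => br s u (q (ns n)))
    ((continuous_fst.tendsto _).comp hlim') ((continuous_snd.tendsto _).comp hlim')
    (fun n => (br_spec (q (ns n)).2).1) (fun n => (br_spec (q (ns n)).2).2)
  refine ⟨φ, ?_⟩
  have : w0 = br s u q0 := H.uniq a b (br_spec q0.2).1 (br_spec q0.2).2
  rw [this] at hφ
  exact hφ

/-- Filling of rectangles. -/
theorem fill (H : HypData g p s u) {α β : ℝ → ℝ × ℝ} (hα : Continuous α) (hβ : Continuous β)
    (a0 b0 : ℝ) (h1 : ∀ a, (α a, β b0) ∈ RR s u) (h2 : ∀ b, (α a0, β b) ∈ RR s u) :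
    ∀ a b, (α a, β b) ∈ RR s u := by
  set G : Set (ℝ × ℝ) := (fun q : ℝ × ℝ => (α q.1, β q.2)) ⁻¹' RR s u with hG
  have hcont : Continuous (fun q : ℝ × ℝ => (α q.1, β q.2)) := by fun_prop
  have hGc : IsClosed G := H.isClosed_RR.preimage hcont
  have hφ : ContinuousOn (fun q : ℝ × ℝ => br s u (α q.1, β q.2)) G :=
    H.continuousOn_br.comp hcont.continuousOn (fun q hq => hq)
  -- local product property
  have loc : ∀ a b, (a, b) ∈ G → ∃ I ∈ 𝓝 a, ∃ J ∈ 𝓝 b, ∀ a' ∈ I, ∀ a'' ∈ I, ∀ b' ∈ J, ∀ b'' ∈ J,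
      (a', b'') ∈ G → (a'', b') ∈ G → (a', b') ∈ G := by
    intro a b hab
    obtain ⟨h, ho, hw, hs, hu⟩ := H.ch (br s u (α a, β b))
    have hN : range h ∈ 𝓝 (br s u (α a, β b)) := ho.isOpen_range.mem_nhds hw
    have := (hφ (a, b) hab) hN
    rw [Filter.mem_map, mem_nhdsWithin_iff_exists_mem_nhds_inter] at this
    obtain ⟨N, hN, hsub⟩ := this
    rw [nhds_prod_eq, mem_prod_iff] at hN
    obtain ⟨I, hI, J, hJ, hIJ⟩ := hN
    refine ⟨I, hI, J, hJ, ?_⟩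
    intro a' ha' a'' ha'' b' hb' b'' hb'' g1 g2
    obtain ⟨⟨x1, x2⟩, hx⟩ := hsub ⟨hIJ ⟨ha', hb''⟩, g1⟩
    obtain ⟨⟨y1, y2⟩, hy⟩ := hsub ⟨hIJ ⟨ha'', hb'⟩, g2⟩
    refine ⟨h (x1, y2), ?_, ?_⟩
    · refine H.sE.trans (hs x1 y2 x2) ?_
      rw [hx]; exact (br_spec g1).1
    · refine H.uE.trans (hu x1 y1 y2) ?_
      rw [hy]; exact (br_spec g2).2
  -- main clopen argument
  intro a b
  set K := Set.uIcc a0 a with hK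
  have ha0 : a0 ∈ K := left_mem_uIcc
  have ha : a ∈ K := right_mem_uIcc
  let E : Set ℝ := {b | ∀ a ∈ K, (a, b) ∈ G}
  have hEc : IsClosed E := by
    have : E = ⋂ a ∈ K, (fun b => (a, b)) ⁻¹' G := by ext; simp [E]
    rw [this]
    exact isClosed_biInter fun a _ => hGc.preimage (by fun_prop)
  have hEo : IsOpen E := by
    rw [isOpen_iff_mem_nhds]
    intro b hb
    have step : ∀ x ∈ K, ∃ I ∈ 𝓝 x, ∃ J ∈ 𝓝 b, ∀ y ∈ I, y ∈ K → ∀ y' ∈ I, y' ∈ K → ∀ b' ∈ J,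
        (y, b') ∈ G → (y', b') ∈ G := by
      intro x hx
      obtain ⟨I, hI, J, hJ, hIJ⟩ := loc x b (hb x hx)
      exact ⟨I, hI, J, hJ, fun y hy hyK y' hy' hyK' b' hb' hG' =>
        hIJ y' hy' y hy b' hb' b (mem_of_mem_nhds hJ) (hb y' hyK') hG'⟩
    have key : ∀ x ∈ K, ∀ᶠ b' in 𝓝 b, (x, b') ∈ G := by
      intro x hx
      have := (isPreconnected_uIcc : IsPreconnected K).induction₂
        (fun x y => (∀ᶠ b' in 𝓝 b, (x, b') ∈ G) ↔ (∀ᶠ b' in 𝓝 b, (y, b') ∈ G))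
        (fun x hx => ?_) (fun x y z _ _ _ h1 h2 => h1.trans h2) (fun x y _ _ h => h.symm) ha0 hx
      · exact this.1 (Eventually.of_forall h2)
      · obtain ⟨I, hI, J, hJ, hIJ⟩ := step x hx
        filter_upwards [mem_nhdsWithin_of_mem_nhds hI, self_mem_nhdsWithin] with y hy hyK
        constructor
        · intro h
          filter_upwards [h, hJ] with b' h1 h2
          exact hIJ x (mem_of_mem_nhds hI) hx y hy hyK b' h2 h1
        · intro h
          filter_upwards [h, hJ] with b' h1 h2
          exact hIJ y hy hyK x (mem_of_mem_nhds hI) hx b' h2 h1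
    have := (isCompact_uIcc : IsCompact K).eventually_forall_of_forall_eventually
      (x₀ := b) (P := fun b' a' => a' ∈ K → (a', b') ∈ G) (fun x hx => ?_)
    · filter_upwards [this] with b' h a' ha'
      exact h a' ha' ha'
    · obtain ⟨I, hI, J, hJ, hIJ⟩ := step x hx
      rw [nhds_prod_eq]
      filter_upwards [prod_mem_prod (inter_mem hJ (key x hx)) hI] with z hz hzK
      exact hIJ x (mem_of_mem_nhds hI) hx z.2 hz.2 hzK z.1 hz.1.1 hz.1.2
  have : E = univ := by
    apply IsClopen.eq_univ ⟨hEc, hEo⟩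
    exact ⟨b0, fun a _ => h1 a⟩
  have hb : b ∈ E := by rw [this]; trivial
  exact hb a ha

/-- Global product structure. -/
theorem exists_homeo (H : HypData g p s u) {α β : ℝ → ℝ × ℝ} (hα : Continuous α)
    (hβ : Continuous β) (hαi : Function.Injective α) (hβi : Function.Injective β)
    (hα0 : α 0 = p) (hβ0 : β 0 = p)
    (hαr : range α = {x | u x p}) (hβr : range β = {x | s x p})
    (hαp : ∀ C : Set (ℝ × ℝ), IsCompact C → ∃ M : ℝ, ∀ t, α t ∈ C → |t| ≤ M)
    (hβp : ∀ C : Set (ℝ × ℝ), IsCompact C → ∃ M : ℝ, ∀ t, β t ∈ C → |t| ≤ M) :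
    ∃ Φ : ℝ × ℝ ≃ₜ ℝ × ℝ, ∀ a b, s (Φ (a, b)) (α a) ∧ u (Φ (a, b)) (β b) := by
  have hαu : ∀ a, u (α a) p := fun a => by
    have : α a ∈ {x | u x p} := hαr ▸ mem_range_self a
    exact this
  have hβs : ∀ b, s (β b) p := fun b => by
    have : β b ∈ {x | s x p} := hβr ▸ mem_range_self b
    exact this
  have hG : ∀ a b, (α a, β b) ∈ RR s u := by
    apply H.fill hα hβ 0 0
    · intro a; exact ⟨α a, H.sE.refl _, by simpa [hβ0] using hαu a⟩
    · intro b; exact ⟨β b, by simpa [hα0] using hβs b, H.uE.refl _⟩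
  let Φ : ℝ × ℝ → ℝ × ℝ := fun q => br s u (α q.1, β q.2)
  have hΦs : ∀ a b, s (Φ (a, b)) (α a) := fun a b => (br_spec (hG a b)).1
  have hΦu : ∀ a b, u (Φ (a, b)) (β b) := fun a b => (br_spec (hG a b)).2
  have hΦc : Continuous Φ := H.continuousOn_br.comp_continuous (by fun_prop) (fun q => hG _ _)
  have hΦi : Function.Injective Φ := by
    rintro ⟨a, b⟩ ⟨a', b'⟩ h
    have e1 : α a = α a' := by
      apply H.su
      · exact H.sE.trans (H.sE.symm (hΦs a b)) (h ▸ hΦs a' b')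
      · exact H.uE.trans (hαu a) (H.uE.symm (hαu a'))
    have e2 : β b = β b' := by
      apply H.su
      · exact H.sE.trans (hβs b) (H.sE.symm (hβs b'))
      · exact H.uE.trans (H.uE.symm (hΦu a b)) (h ▸ hΦu a' b')
    rw [hαi e1, hβi e2]
  have hprop : IsProperMap Φ := by
    rw [isProperMap_iff_tendsto_cocompact]
    refine ⟨hΦc, ?_⟩
    rw [(hasBasis_cocompact).tendsto_right_iff]
    intro K hK
    obtain ⟨R, hR⟩ := H.bd _ (hK.insert p)
    obtain ⟨M1, hM1⟩ := hαp _ (isCompact_closedBall 0 R)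
    obtain ⟨M2, hM2⟩ := hβp _ (isCompact_closedBall 0 R)
    refine mem_cocompact.2 ⟨Icc (-M1) M1 ×ˢ Icc (-M2) M2, isCompact_Icc.prod isCompact_Icc, ?_⟩
    rintro ⟨a, b⟩ hab
    by_contra hcon
    have hin : Φ (a, b) ∈ K := by simpa using hcon
    apply hab
    refine ⟨abs_le.1 (hM1 a ?_), abs_le.1 (hM2 b ?_)⟩
    · rw [mem_closedBall_zero_iff]
      exact hR _ ⟨_, Or.inr hin, H.sE.symm (hΦs a b)⟩ ⟨p, Or.inl rfl, hαu a⟩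
    · rw [mem_closedBall_zero_iff]
      exact hR _ ⟨p, Or.inl rfl, hβs b⟩ ⟨_, Or.inr hin, H.uE.symm (hΦu a b)⟩
  have hcl : IsClosed (range Φ) := hprop.isClosedMap.isClosed_range
  have hop : IsOpen (range Φ) := by
    rw [isOpen_iff_mem_nhds]
    rintro _ ⟨⟨a, b⟩, rfl⟩
    obtain ⟨h, ho, ⟨⟨c, d⟩, hw⟩, hs, hu⟩ := H.ch (Φ (a, b))
    have hcu : ∀ c' , u (h (c', d)) (β b) := fun c' =>
      H.uE.trans (hu c' c d) (hw ▸ hΦu a b)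
    have hds : ∀ d' , s (h (c, d')) (α a) := fun d' =>
      H.sE.trans (hs c d' d) (hw ▸ hΦs a b)
    have f1 := H.fill (α := fun c' => h (c', d)) (β := β) (ho.continuous.comp (by fun_prop)) hβ c b
      (fun c' => ⟨h (c', d), H.sE.refl _, hcu c'⟩)
      (fun b' => ⟨Φ (a, b'), H.sE.trans (hΦs a b') (H.sE.symm (hds d)), hΦu a b'⟩)
    have f2 := H.fill (α := α) (β := fun d' => h (c, d')) hα (ho.continuous.comp (by fun_prop)) a d
      (fun a' => ⟨Φ (a', b), hΦs a' b, H.uE.trans (hΦu a' b) (H.uE.symm (hcu c))⟩)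
      (fun d' => ⟨h (c, d'), hds d', H.uE.refl _⟩)
    refine mem_of_superset (ho.isOpen_range.mem_nhds ⟨(c, d), hw⟩) ?_
    rintro _ ⟨⟨c', d'⟩, rfl⟩
    obtain ⟨w1, h1, h1'⟩ := f1 c' 0
    obtain ⟨w2, h2, h2'⟩ := f2 0 d'
    simp only [hβ0, hα0] at h1 h1' h2 h2'
    have m1 : w1 ∈ range α := by rw [hαr]; exact h1'
    have m2 : w2 ∈ range β := by rw [hβr]; exact h2
    obtain ⟨a', rfl⟩ := m1
    obtain ⟨b', rfl⟩ := m2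
    refine ⟨(a', b'), H.uniq (hΦs a' b') (hΦu a' b') ?_ ?_⟩
    · exact H.sE.trans (hs c' d' d) (H.sE.symm h1)
    · exact H.uE.trans (hu c' c d') (H.uE.symm h2')
  have hsurj : Function.Surjective Φ := by
    rw [← range_eq_univ]
    exact IsClopen.eq_univ ⟨hcl, hop⟩ ⟨_, mem_range_self (0, 0)⟩
  let e := Equiv.ofBijective Φ ⟨hΦi, hsurj⟩
  refine ⟨e.toHomeomorphOfContinuousClosed hΦc hprop.isClosedMap, fun a b => ⟨hΦs a b, hΦu a b⟩⟩

end HypData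

theorem seq_cross (x : ℤ → ℝ) (F : ℝ → ℝ) (hF : Continuous F) (hlt : ∀ t, 0 < t → F t < t)
    (hx : ∀ n, 0 < x n) (hxs : ∀ n, x (n + 1) = F (x n)) : ∃ n, x n ≤ 1 ∧ 1 < x (n - 1) := by
  have hanti : Antitone x := antitone_int_of_succ_le fun n => by
    rw [hxs]; exact (hlt _ (hx n)).le
  have h1 : ∃ n, x n ≤ 1 := by
    by_contra! h
    have hanti' : Antitone (fun n : ℕ => x n) := fun a b hab => hanti (by exact_mod_cast hab)
    have hb : BddBelow (range fun n : ℕ => x n) := ⟨0, by rintro _ ⟨n, rfl⟩; exact (hx _).le⟩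
    have hl := tendsto_atTop_ciInf hanti' hb
    set L := ⨅ n : ℕ, x n
    have hL : 1 ≤ L := le_ciInf fun n => (h n).le
    have h2 : Tendsto (fun n : ℕ => x ((n + 1 : ℕ) : ℤ)) atTop (𝓝 L) :=
      hl.comp (tendsto_add_atTop_nat 1)
    have h3 : Tendsto (fun n : ℕ => x ((n + 1 : ℕ) : ℤ)) atTop (𝓝 (F L)) := by
      refine ((hF.tendsto L).comp hl).congr fun n => ?_
      simp [hxs]
    have := tendsto_nhds_unique h2 h3
    have := hlt L (by linarith)
    linarith
  have h2 : ∃ n, 1 < x n := by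
    by_contra! h
    have hm : Monotone (fun n : ℕ => x (-n)) := fun a b hab => hanti (by simpa using hab)
    have hb : BddAbove (range fun n : ℕ => x (-n)) := ⟨1, by rintro _ ⟨n, rfl⟩; exact h _⟩
    have hl := tendsto_atTop_ciSup hm hb
    set L := ⨆ n : ℕ, x (-n)
    have hL : 0 < L := (hx _).trans_le (le_ciSup hb 0)
    have h2 : Tendsto (fun n : ℕ => x (-((n + 1 : ℕ) : ℤ))) atTop (𝓝 L) :=
      hl.comp (tendsto_add_atTop_nat 1)
    have h3 : Tendsto (fun n : ℕ => x (-(n : ℤ))) atTop (𝓝 (F L)) := by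
      refine ((hF.tendsto L).comp h2).congr fun n => ?_
      simp only [Function.comp, ← hxs]
      congr 1; push_cast; ring
    have := tendsto_nhds_unique hl h3
    have := hlt L (by linarith)
    linarith
  obtain ⟨b, hb⟩ := h2
  obtain ⟨n, hn, hmin⟩ := Int.exists_least_of_bdd (P := fun n => x n ≤ 1)
    ⟨b, fun z hz => by
      by_contra! hc
      have := hanti hc.le
      linarith⟩ h1
  refine ⟨n, hn, ?_⟩
  by_contra! hc
  have := hmin _ hc
  lia

theorem theta_exists (A B : ℝ) (hA : -1 < A) (hA0 : A < 0) (hB0 : 0 < B) (hB : B < 1) :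
    ∃ θ : ℝ → ℝ, Continuous θ ∧ Monotone θ ∧ (∀ t, |θ t| ≤ 2) ∧ (∀ t ∈ Ioo A B, θ t = 0) ∧
      (∀ a b, a < b → B < b → b ≤ 1 → θ a < θ b) ∧ (∀ a b, a < b → -1 ≤ a → a < A → θ a < θ b) := by
  refine ⟨fun t => max (-1) (min t 1) - max A (min t B), by fun_prop, ?_, ?_, ?_, ?_, ?_⟩
  · intro a b hab
    show max (-1) (min a 1) - max A (min a B) ≤ max (-1) (min b 1) - max A (min b B)
    grind
  · intro t
    rw [abs_le]
    grind
  · intro t ⟨h1, h2⟩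
    grind
  · intro a b h1 h2 h3
    grind
  · intro a b h1 h2 h3
    grind

set_option maxHeartbeats 800000 in
theorem conj_lemma (Γ : ℝ ≃o ℝ) (h0 : Γ 0 = 0) (hpos : ∀ t, 0 < t → Γ t < t)
    (hneg : ∀ t, t < 0 → t < Γ t) : ∃ ψ : ℝ ≃o ℝ, ∀ t, ψ (Γ t) = ψ t / 4 := by
  have hA : -1 < Γ (-1) := hneg _ (by norm_num)
  have hA0 : Γ (-1) < 0 := by rw [← h0]; exact Γ.strictMono (by norm_num)
  have hB : Γ 1 < 1 := hpos _ (by norm_num)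
  have hB0 : 0 < Γ 1 := by
    have := Γ.strictMono (zero_lt_one : (0:ℝ) < 1); rwa [h0] at this
  set A := Γ (-1) with hAd
  set B := Γ 1 with hBd
  have hs : ∀ (n : ℤ) t, (Γ ^ (n + 1)) t = Γ ((Γ ^ n) t) := by
    intro n t; rw [add_comm, zpow_add, zpow_one]; rfl
  have hs' : ∀ (n : ℤ) t, (Γ ^ (n + 1)) t = (Γ ^ n) (Γ t) := by
    intro n t; rw [zpow_add, zpow_one]; rfl
  have hz : ∀ n : ℤ, (Γ ^ n) 0 = 0 := by
    intro n
    induction n with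
    | zero => simp
    | succ n ih => rw [hs, ih, h0]
    | pred n ih =>
      apply Γ.injective
      rw [← hs, h0]; simpa using ih
  have hpp : ∀ (n : ℤ) t, 0 < t → 0 < (Γ ^ n) t := fun n t ht => by
    have := (Γ ^ n).strictMono ht; rwa [hz] at this
  have hnn : ∀ (n : ℤ) t, t < 0 → (Γ ^ n) t < 0 := fun n t ht => by
    have := (Γ ^ n).strictMono ht; rwa [hz] at this
  have crossP : ∀ t, 0 < t → ∃ n : ℤ, (Γ ^ n) t ≤ 1 ∧ B < (Γ ^ n) t := by
    intro t ht
    obtain ⟨n, h1, h2⟩ := seq_cross (fun n => (Γ ^ n) t) Γ Γ.continuous hpos (fun n => hpp n t ht)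
      (fun n => hs n t)
    refine ⟨n, h1, ?_⟩
    have := Γ.strictMono h2
    rw [← hs] at this; simpa using this
  have crossN : ∀ t, t < 0 → ∃ n : ℤ, -1 ≤ (Γ ^ n) t ∧ (Γ ^ n) t < A := by
    intro t ht
    obtain ⟨n, h1, h2⟩ := seq_cross (fun n => -(Γ ^ n) t) (fun t => -Γ (-t))
      (Γ.continuous.comp continuous_neg).neg
      (fun t ht => by have := hneg (-t) (by linarith); linarith) (fun n => by
        have := hnn n t ht; linarith)
      (fun n => by simp [hs n t])
    refine ⟨n, by linarith, ?_⟩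
    have := Γ.strictMono (show (Γ ^ (n - 1)) t < -1 by linarith)
    rw [← hs] at this; simpa using this
  have small : ∀ t, ∃ N : ℤ, (Γ ^ N) t ∈ Ioo A B := by
    intro t
    rcases lt_trichotomy t 0 with h | h | h
    · obtain ⟨n, h1, h2⟩ := crossN t h
      refine ⟨n + 1 + 1, ?_, (hnn _ t h).trans hB0⟩
      have h3 := Γ.monotone h1
      have h4 := hneg _ (hnn (n + 1) t h)
      rw [← hs] at h3 h4
      linarith
    · subst h; exact ⟨0, by simpa using hA0, by simpa using hB0⟩
    · obtain ⟨n, h1, h2⟩ := crossP t h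
      refine ⟨n + 1 + 1, hA0.trans (hpp _ t h), ?_⟩
      have h3 := Γ.monotone h1
      have h4 := hpos _ (hpp (n + 1) t h)
      rw [← hs] at h3 h4
      linarith
  have hAB : ∀ t, t ∈ Ioo A B → Γ t ∈ Ioo A B := by
    intro t ⟨h1, h2⟩
    constructor
    · have := Γ.strictMono h1
      have := hneg A hA0
      linarith
    · have := Γ.strictMono h2
      have := hpos B hB0
      linarith
  have stay : ∀ (N : ℤ) t, (Γ ^ N) t ∈ Ioo A B → ∀ n, N ≤ n → (Γ ^ n) t ∈ Ioo A B := by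
    intro N t h n hn
    induction n, hn using Int.leInduction with
    | base => exact h
    | succ n _ ih => rw [hs]; exact hAB _ ih
  obtain ⟨θ, θc, θm, θb, θz, θsP, θsN⟩ := theta_exists A B hA hA0 hB0 hB
  let T : ℤ → ℝ → ℝ := fun n t => (4:ℝ) ^ n * θ ((Γ ^ n) t)
  have bsum : ∀ N : ℤ, Summable (fun n : ℤ => if n < N then 2 * (4:ℝ) ^ n else 0) := by
    intro N
    apply Summable.of_nat_of_neg
    · apply summable_of_hasFiniteSupport
      refine (Set.finite_lt_nat N.toNat).subset ?_
      intro n hn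
      simp only [Function.mem_support, ne_eq, ite_eq_right_iff, not_forall] at hn
      obtain ⟨h, -⟩ := hn
      simp only [mem_ofPred_eq]; lia
    · have : Summable (fun n : ℕ => 2 * ((4:ℝ)⁻¹) ^ n) :=
        (summable_geometric_of_lt_one (by norm_num) (by norm_num)).mul_left 2
      refine Summable.of_nonneg_of_le (fun n => ?_) (fun n => ?_) this
      · split_ifs <;> positivity
      · split_ifs
        · rw [zpow_neg, zpow_natCast, inv_pow]
        · positivity
  have Tb : ∀ (N : ℤ) t, (Γ ^ N) t ∈ Ioo A B → ∀ n, ‖T n t‖ ≤ if n < N then 2 * (4:ℝ) ^ n else 0 := by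
    intro N t h n
    split_ifs with hn
    · simp only [T, norm_mul, Real.norm_eq_abs, abs_of_pos (zpow_pos (by norm_num : (0:ℝ) < 4) n)]
      have := θb ((Γ ^ n) t)
      have h4 := zpow_pos (by norm_num : (0:ℝ) < 4) n
      nlinarith
    · simp [T, θz _ (stay N t h n (not_lt.1 hn))]
  have Tsum : ∀ t, Summable (fun n => T n t) := by
    intro t
    obtain ⟨N, hN⟩ := small t
    exact Summable.of_norm_bounded (bsum N) (Tb N t hN)
  let ψ : ℝ → ℝ := fun t => ∑' n, T n t
  have ψc : Continuous ψ := by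
    rw [continuous_iff_continuousAt]
    intro t
    obtain ⟨N, hN⟩ := small t
    have hop : IsOpen ((Γ ^ N) ⁻¹' Ioo A B) := isOpen_Ioo.preimage (Γ ^ N).continuous
    refine ContinuousOn.continuousAt ?_ (hop.mem_nhds hN)
    refine continuousOn_tsum (fun n => ?_) (bsum N) (fun n x hx => Tb N x hx n)
    exact (continuous_const.mul (θc.comp (Γ ^ n).continuous)).continuousOn
  have ψf : ∀ t, ψ (Γ t) = ψ t / 4 := by
    intro t
    have e : ψ t = ∑' n, T (n + 1) t := ((Equiv.addRight (1:ℤ)).tsum_eq (fun n => T n t)).symm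
    have : ∀ n, T (n + 1) t = 4 * T n (Γ t) := by
      intro n
      simp only [T, hs']
      rw [zpow_add_one₀ (by norm_num)]; ring
    rw [e]
    simp_rw [this]
    rw [tsum_mul_left]; simp only [ψ]; ring
  have Tm : ∀ n, Monotone (T n) := fun n a b hab =>
    mul_le_mul_of_nonneg_left (θm ((Γ ^ n).monotone hab)) (zpow_pos (by norm_num) n).le
  have ψs : StrictMono ψ := by
    intro a b hab
    have : ∃ n, T n a < T n b := by
      rcases lt_or_ge 0 b with h | h
      · obtain ⟨n, h1, h2⟩ := crossP b h
        exact ⟨n, mul_lt_mul_of_pos_left (θsP _ _ ((Γ ^ n).strictMono hab) h2 h1)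
          (zpow_pos (by norm_num) n)⟩
      · obtain ⟨n, h1, h2⟩ := crossN a (by linarith)
        exact ⟨n, mul_lt_mul_of_pos_left (θsN _ _ ((Γ ^ n).strictMono hab) h1 h2)
          (zpow_pos (by norm_num) n)⟩
    obtain ⟨n, hn⟩ := this
    exact (Tsum a).tsum_lt_tsum (fun n => Tm n hab.le) hn (Tsum b)
  have ψ0 : ψ 0 = 0 := by have := ψf 0; rw [h0] at this; linarith
  have ψinv : ∀ (n : ℕ) t, ψ ((Γ.symm)^[n] t) = 4 ^ n * ψ t := by
    intro n
    induction n with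
    | zero => simp
    | succ n ih =>
      intro t
      have := ψf (Γ.symm t)
      rw [Γ.apply_symm_apply] at this
      rw [Function.iterate_succ_apply, ih, this, pow_succ]; ring
  have hp1 : 0 < ψ 1 := by rw [← ψ0]; exact ψs zero_lt_one
  have hn1 : ψ (-1) < 0 := by rw [← ψ0]; exact ψs (by norm_num)
  have h4 : Tendsto (fun n : ℕ => (4:ℝ) ^ n) atTop atTop := tendsto_pow_atTop_atTop_of_one_lt (by norm_num)
  have surj : Function.Surjective ψ := by
    intro y
    obtain ⟨n, hn⟩ := (h4.eventually_ge_atTop (y / ψ 1)).exists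
    obtain ⟨m, hm⟩ := (h4.eventually_ge_atTop (y / ψ (-1))).exists
    rw [div_le_iff₀ hp1, ← ψinv] at hn
    rw [div_le_iff_of_neg hn1, ← ψinv] at hm
    obtain ⟨x, hx⟩ := mem_range_of_exists_le_of_exists_ge ψc ⟨_, hm⟩ ⟨_, hn⟩
    exact ⟨x, hx⟩
  exact ⟨StrictMono.orderIsoOfSurjective ψ ψs surj, fun t => ψf t⟩

/-- Clamp extension of a local increasing contraction. -/
theorem extend_conj (δ : ℝ) (hδ : 0 < δ) (γ : ℝ → ℝ) (hc : ContinuousOn γ (Icc (-δ) δ))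
    (hm : StrictMonoOn γ (Icc (-δ) δ)) (h0 : γ 0 = 0)
    (hpos : ∀ t, 0 < t → t ≤ δ → γ t < t) (hneg : ∀ t, -δ ≤ t → t < 0 → t < γ t) :
    ∃ ψ : ℝ ≃o ℝ, ∀ t ∈ Icc (-δ) δ, ψ (γ t) = ψ t / 4 := by
  let c : ℝ → ℝ := fun t => max (-δ) (min t δ)
  have cI : ∀ t, c t ∈ Icc (-δ) δ := fun t =>
    ⟨le_max_left _ _, max_le (by linarith) (min_le_right _ _)⟩
  have cid : ∀ t ∈ Icc (-δ) δ, c t = t := fun t ht => by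
    simp only [c, min_eq_left ht.2, max_eq_right ht.1]
  have cc : Continuous c := by fun_prop
  have cm : Monotone c := fun a b hab => by simp only [c]; gcongr
  have cn : ∀ a b, a ≤ b → c b - c a ≤ b - a := fun a b hab => by simp only [c]; grind
  let Γ : ℝ → ℝ := fun t => γ (c t) + (t - c t)
  have Γc : Continuous Γ := (hc.comp_continuous cc cI).add (continuous_id.sub cc)
  have Γs : StrictMono Γ := by
    intro a b hab
    simp only [Γ]
    rcases (cm hab.le).lt_or_eq with h | h
    · have := hm (cI a) (cI b) h
      have := cn a b hab.le
      linarith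
    · rw [h]; linarith
  have Γb : ∀ t, |γ (c t) - c t| ≤ δ := by
    intro t
    have h1 := cI t
    have hz : (0:ℝ) ∈ Icc (-δ) δ := ⟨by linarith, hδ.le⟩
    rw [abs_le]
    rcases lt_trichotomy (c t) 0 with h | h | h
    · have h2 := hneg _ h1.1 h
      have h3 := hm h1 hz h
      rw [h0] at h3
      constructor <;> linarith [h1.1]
    · rw [h, h0]; constructor <;> linarith
    · have h2 := hpos _ h h1.2
      have h3 := hm hz h1 h
      rw [h0] at h3
      constructor <;> linarith [h1.2]
  have Γsurj : Function.Surjective Γ := by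
    intro y
    have h1 : Γ (y - δ) ≤ y := by have := abs_le.1 (Γb (y - δ)); simp only [Γ]; linarith
    have h2 : y ≤ Γ (y + δ) := by have := abs_le.1 (Γb (y + δ)); simp only [Γ]; linarith
    exact mem_range_of_exists_le_of_exists_ge Γc ⟨_, h1⟩ ⟨_, h2⟩
  have cpos : ∀ t, 0 < t → 0 < c t := fun t ht => by simp only [c]; grind
  have cneg : ∀ t, t < 0 → c t < 0 := fun t ht => by simp only [c]; grind
  obtain ⟨ψ, hψ⟩ := conj_lemma (StrictMono.orderIsoOfSurjective Γ Γs Γsurj)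
    (by
      have : c 0 = 0 := cid 0 ⟨by linarith, hδ.le⟩
      simp [Γ, this, h0])
    (fun t ht => by
      have := hpos (c t) (cpos t ht) (cI t).2
      simp only [StrictMono.coe_orderIsoOfSurjective, Γ]; linarith)
    (fun t ht => by
      have := hneg (c t) (cI t).1 (cneg t ht)
      simp only [StrictMono.coe_orderIsoOfSurjective, Γ]; linarith)
  refine ⟨ψ, fun t ht => ?_⟩
  have := hψ t
  simp only [StrictMono.coe_orderIsoOfSurjective, Γ, cid t ht] at this
  simpa using this

namespace HypData
variable {g : ℝ × ℝ ≃ₜ ℝ × ℝ} {p : ℝ × ℝ} {s u : ℝ × ℝ → ℝ × ℝ → Prop}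

theorem s_iter (H : HypData g p s u) (n : ℕ) (x : ℝ × ℝ) : s (g^[n] x) p ↔ s x p := by
  induction n with
  | zero => rfl
  | succ n ih =>
    rw [Function.iterate_succ_apply', ← ih]
    conv_lhs => rw [← H.gp]
    rw [H.sg]

/-- Local coordinate on the stable class of `p`. -/
theorem local_arc (H : HypData g p s u) : ∃ (k : ℝ → ℝ × ℝ), IsEmbedding k ∧ k 0 = p ∧
    (∀ t, s (k t) p) ∧
    (∀ δ > 0, ∃ N, IsOpen N ∧ p ∈ N ∧ ∀ x ∈ N, s x p → ∃ t, |t| < δ ∧ x = k t) := by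
  obtain ⟨h, ho, ⟨⟨a0, b0⟩, hp⟩, hs, hu⟩ := H.ch p
  have hemb : IsEmbedding (fun t : ℝ => (a0, b0 + t)) :=
    (isEmbedding_prodMkRight a0).comp (Homeomorph.addLeft b0).isEmbedding
  refine ⟨fun t => h (a0, b0 + t), ho.isEmbedding.comp hemb, by simpa using hp, ?_, ?_⟩
  · intro t; rw [← hp]; exact hs _ _ _
  · intro δ hδ
    refine ⟨h '' (univ ×ˢ Metric.ball b0 δ), ho.isOpenMap _ (isOpen_univ.prod Metric.isOpen_ball),
      ⟨(a0, b0), ⟨trivial, Metric.mem_ball_self hδ⟩, hp⟩, ?_⟩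
    rintro _ ⟨⟨a, b⟩, ⟨-, hb⟩, rfl⟩ hsx
    have e : h (a, b0) = h (a0, b0) := H.su _ _
      (H.sE.trans (hs a b0 b) (hp ▸ hsx)) (hu _ _ _)
    have ea : a = a0 := congrArg Prod.fst (ho.injective e)
    refine ⟨b - b0, by simpa [Real.dist_eq] using hb, ?_⟩
    rw [ea]; simp

/-- Near `p` the stable class is an arc on which `g ∘ g` is linearized. -/
theorem local_conj (H : HypData g p s u) : ∃ (k : ℝ → ℝ × ℝ) (δ : ℝ) (N : Set (ℝ × ℝ)) (ψ : ℝ ≃o ℝ),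
    0 < δ ∧ IsEmbedding k ∧ k 0 = p ∧ (∀ t, s (k t) p) ∧ IsOpen N ∧ p ∈ N ∧
    (∀ x ∈ N, s x p → ∃ t, |t| ≤ δ ∧ x = k t) ∧
    (∀ t, |t| ≤ δ → |ψ.symm (ψ t / 4)| ≤ δ ∧ g (g (k t)) = k (ψ.symm (ψ t / 4))) := by
  obtain ⟨k, hk, hk0, hks, hkN⟩ := H.local_arc
  -- stability in coordinates
  have stab : ∀ δ > 0, ∃ δ' > 0, ∀ t, |t| ≤ δ' → ∀ n : ℕ, ∃ t', |t'| < δ ∧ g^[n] (k t) = k t' := by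
    intro δ hδ
    obtain ⟨N, hN, hpN, hNk⟩ := hkN δ hδ
    obtain ⟨M, hM, hMN⟩ := H.sstab N (hN.mem_nhds hpN)
    have : k ⁻¹' M ∈ 𝓝 (0:ℝ) := hk.continuous.continuousAt (by rwa [hk0])
    obtain ⟨δ', hδ', hsub⟩ := Metric.nhds_basis_closedBall.mem_iff.1 this
    refine ⟨δ', hδ', fun t ht n => ?_⟩
    exact hNk _ (hMN _ (hsub (by simpa using ht)) (hks t) n) ((H.s_iter n _).2 (hks t))
  obtain ⟨δ0, hδ0, st0⟩ := stab 1 one_pos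
  obtain ⟨δ1, hδ1, st1⟩ := stab δ0 hδ0
  obtain ⟨δ2', hδ2', st2'⟩ := stab δ1 hδ1
  obtain ⟨δ, hδ, hd1, st2⟩ : ∃ δ > 0, δ ≤ δ1 ∧
      ∀ t, |t| ≤ δ → ∀ n : ℕ, ∃ t', |t'| < δ1 ∧ g^[n] (k t) = k t' :=
    ⟨min δ1 δ2', lt_min hδ1 hδ2', min_le_left _ _, fun t ht => st2' t (ht.trans (min_le_right _ _))⟩
  have hex : ∀ t, ∃ t', |t| ≤ δ0 → g (k t) = k t' := by
    intro t
    by_cases ht : |t| ≤ δ0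
    · obtain ⟨t', -, h⟩ := st0 t ht 1
      exact ⟨t', fun _ => h⟩
    · exact ⟨0, fun h => absurd h ht⟩
  choose γ hγ using hex
  have γI : ∀ t, |t| ≤ δ1 → |γ t| < δ0 := by
    intro t ht
    obtain ⟨t', h1, h2⟩ := st1 t ht 1
    have hd : |t| ≤ δ0 := by
      obtain ⟨t', h1, h2⟩ := st1 t ht 0
      rw [hk.injective (show k t = k t' from h2)]; exact h1.le
    have := (hγ t hd).symm.trans h2
    rwa [hk.injective this]
  have hd01 : δ1 ≤ δ0 := by
    obtain ⟨t', h1, h2⟩ := st1 δ1 (by rw [abs_of_pos hδ1]) 0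
    have := hk.injective (show k δ1 = k t' from h2)
    rw [← this, abs_of_pos hδ1] at h1; exact h1.le
  have γc : ContinuousOn γ (Icc (-δ0) δ0) := by
    rw [hk.isInducing.continuousOn_iff]
    refine (g.continuous.comp hk.continuous).continuousOn.congr fun t ht => ?_
    exact (hγ t (abs_le.2 ht)).symm
  have γi : InjOn γ (Icc (-δ0) δ0) := by
    intro a ha b hb hab
    apply hk.injective
    apply g.injective
    rw [hγ a (abs_le.2 ha), hγ b (abs_le.2 hb), hab]
  have γ0 : γ 0 = 0 := by
    have := hγ 0 (by simpa using hδ0.le)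
    rw [hk0, H.gp, ← hk0] at this
    exact (hk.injective this).symm
  have maps : MapsTo γ (Icc (-δ1) δ1) (Icc (-δ0) δ0) := fun t ht =>
    abs_le.1 (γI t (abs_le.2 ht)).le
  have sub1 : Icc (-δ1) δ1 ⊆ Icc (-δ0) δ0 := Icc_subset_Icc (by linarith) hd01
  have γγmono : StrictMonoOn (γ ∘ γ) (Icc (-δ1) δ1) := by
    rcases ContinuousOn.strictMonoOn_of_injOn_Icc' (by linarith) γc γi with h | h
    · exact h.comp (h.mono sub1) maps
    · exact h.comp (h.mono sub1) maps
  have γγcont : ContinuousOn (γ ∘ γ) (Icc (-δ1) δ1) := γc.comp (γc.mono sub1) maps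
  have γγcomm : ∀ t, |t| ≤ δ1 → g (g (k t)) = k (γ (γ t)) := by
    intro t ht
    rw [hγ t (ht.trans hd01), hγ (γ t) (γI t ht).le]
  have γγzero : (γ ∘ γ) 0 = 0 := by simp [γ0]
  -- the orbit of `t` under `γ ∘ γ`
  have orb : ∀ t, |t| ≤ δ → ∀ n : ℕ, |(γ ∘ γ)^[n] t| < δ1 ∧ k ((γ ∘ γ)^[n] t) = g^[2 * n] (k t) := by
    intro t ht n
    induction n with
    | zero =>
      obtain ⟨t', h1, h2⟩ := st2 t ht 0
      have := hk.injective (show k t = k t' from h2)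
      exact ⟨by simpa [this] using h1, by simp⟩
    | succ n ih =>
      have e : k ((γ ∘ γ)^[n + 1] t) = g^[2 * (n + 1)] (k t) := by
        rw [Function.iterate_succ_apply', Function.comp, ← γγcomm _ ih.1.le, ih.2,
          show 2 * (n + 1) = 2 * n + 1 + 1 by ring, Function.iterate_succ_apply',
          Function.iterate_succ_apply']
      refine ⟨?_, e⟩
      obtain ⟨t', h1, h2⟩ := st2 t ht (2 * (n + 1))
      rw [← e] at h2
      rwa [hk.injective h2]
  have orb0 : ∀ t, |t| ≤ δ → t ≠ 0 → ∃ n : ℕ, |(γ ∘ γ)^[n] t| < |t| := by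
    intro t ht ht0
    obtain ⟨N, hN, hpN, hNk⟩ := hkN |t| (abs_pos.2 ht0)
    have h1 := (H.sconv _ (hks t)).eventually (hN.mem_nhds hpN)
    obtain ⟨m, hm⟩ := eventually_atTop.1 h1
    obtain ⟨t', h2, h3⟩ := hNk _ (hm (2 * m) (by lia)) ((H.s_iter _ _).2 (hks t))
    refine ⟨m, ?_⟩
    rw [← (orb t ht m).2] at h3
    rwa [hk.injective h3]
  have hpos : ∀ t, 0 < t → t ≤ δ → (γ ∘ γ) t < t := by
    intro t h1 h2
    by_contra! hc
    have ht : |t| ≤ δ := by rwa [abs_of_pos h1]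
    obtain ⟨n, hn⟩ := orb0 t ht h1.ne'
    have : ∀ n : ℕ, t ≤ (γ ∘ γ)^[n] t := by
      intro n
      induction n with
      | zero => simp
      | succ n ih =>
        rw [Function.iterate_succ_apply']
        exact hc.trans (γγmono.monotoneOn (abs_le.1 (ht.trans hd1)) (abs_le.1 (orb t ht n).1.le) ih)
    rw [abs_of_pos h1] at hn
    have := this n
    have := le_abs_self ((γ ∘ γ)^[n] t)
    linarith
  have hneg : ∀ t, -δ ≤ t → t < 0 → t < (γ ∘ γ) t := by
    intro t h2 h1
    by_contra! hc
    have ht : |t| ≤ δ := by rw [abs_of_neg h1]; linarith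
    obtain ⟨n, hn⟩ := orb0 t ht h1.ne
    have : ∀ n : ℕ, (γ ∘ γ)^[n] t ≤ t := by
      intro n
      induction n with
      | zero => simp
      | succ n ih =>
        rw [Function.iterate_succ_apply']
        exact (γγmono.monotoneOn (abs_le.1 (orb t ht n).1.le) (abs_le.1 (ht.trans hd1)) ih).trans hc
    rw [abs_of_neg h1] at hn
    have := this n
    have := neg_le_abs ((γ ∘ γ)^[n] t)
    linarith
  have sub2 : Icc (-δ) δ ⊆ Icc (-δ1) δ1 := Icc_subset_Icc (by linarith) hd1
  obtain ⟨ψ, hψ⟩ := extend_conj δ hδ (γ ∘ γ) (γγcont.mono sub2) (γγmono.mono sub2) γγzero hpos hneg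
  obtain ⟨N, hN, hpN, hNk⟩ := hkN δ hδ
  refine ⟨k, δ, N, ψ, hδ, hk, hk0, hks, hN, hpN, fun x hx hs => ?_, fun t ht => ?_⟩
  · obtain ⟨t, h1, h2⟩ := hNk x hx hs
    exact ⟨t, h1.le, h2⟩
  · have e : ψ.symm (ψ t / 4) = (γ ∘ γ) t := by
      rw [← hψ t (abs_le.1 ht), ψ.symm_apply_apply]
    rw [e]
    refine ⟨?_, γγcomm t (ht.trans hd1)⟩
    have hz : (0:ℝ) ∈ Icc (-δ) δ := ⟨by linarith, hδ.le⟩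
    have hI := abs_le.1 ht
    rw [abs_le]
    rcases lt_trichotomy t 0 with h | h | h
    · have h2 := hneg _ hI.1 h
      have h3 := γγmono (sub2 hI) (sub2 hz) h
      rw [γγzero] at h3
      constructor <;> linarith
    · rw [h, γγzero]; exact hz
    · have h2 := hpos _ h hI.2
      have h3 := γγmono (sub2 hz) (sub2 hI) h
      rw [γγzero] at h3
      constructor <;> linarith

/-- The stable class of `p` is a properly embedded line. -/
theorem exists_arc (H : HypData g p s u) : ∃ α : ℝ → ℝ × ℝ, Continuous α ∧ Function.Injective α ∧
    range α = {x | s x p} ∧ α 0 = p ∧ (∀ t, g (g (α t)) = α (t / 4)) ∧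
    (∀ C : Set (ℝ × ℝ), IsCompact C → ∃ M : ℝ, ∀ t, α t ∈ C → |t| ≤ M) := by
  obtain ⟨k, δ, N, ψ, hδ, hk, hk0, hks, hN, hpN, hNk, hg⟩ := H.local_conj
  have ψ0 : ψ 0 = 0 := by
    have h := (hg 0 (by simpa using hδ.le)).2
    rw [hk0, H.gp, H.gp, ← hk0] at h
    have h := hk.injective h
    have h2 : ψ 0 = ψ 0 / 4 := by
      conv_lhs => rw [h]
      simp
    linarith
  let F : ℕ → ℝ → ℝ × ℝ := fun m t => g.symm^[2 * m] (k (ψ.symm (t / 4 ^ m)))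
  let good : ℕ → ℝ → Prop := fun m t => |ψ.symm (t / 4 ^ m)| ≤ δ
  have inv : ∀ (n : ℕ) x, g^[n] (g.symm^[n] x) = x := fun n x =>
    (Function.LeftInverse.iterate g.apply_symm_apply n) x
  have inv' : ∀ (n : ℕ) x, g.symm^[n] (g^[n] x) = x := fun n x =>
    (Function.LeftInverse.iterate g.symm_apply_apply n) x
  have two : ∀ (m : ℕ) x, g.symm^[2 * (m + 1)] x = g.symm^[2 * m] (g.symm (g.symm x)) := by
    intro m x
    rw [show 2 * (m + 1) = 2 * m + 1 + 1 by ring, Function.iterate_succ_apply,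
      Function.iterate_succ_apply]
  have step : ∀ m t, good m t → good (m + 1) t ∧ F (m + 1) t = F m t := by
    intro m t h
    obtain ⟨h1, h2⟩ := hg _ h
    rw [ψ.apply_symm_apply, div_div, ← pow_succ] at h1 h2
    refine ⟨h1, ?_⟩
    simp only [F]
    rw [two, ← h2]
    simp
  have stepn : ∀ m t, good m t → ∀ n, m ≤ n → good n t ∧ F n t = F m t := by
    intro m t h n hn
    induction n, hn using Nat.le_induction with
    | base => exact ⟨h, rfl⟩
    | succ n _ ih =>
      obtain ⟨h1, h2⟩ := step n t ih.1
      exact ⟨h1, h2.trans ih.2⟩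
  have exgood : ∀ t, ∃ m, |ψ.symm (t / 4 ^ m)| < δ := by
    intro t
    have h1 : Tendsto (fun m : ℕ => t / 4 ^ m) atTop (𝓝 0) :=
      tendsto_const_nhds.div_atTop (tendsto_pow_atTop_atTop_of_one_lt (by norm_num))
    have h2 : Tendsto (fun m : ℕ => |ψ.symm (t / 4 ^ m)|) atTop (𝓝 0) := by
      have := ((continuous_abs.comp ψ.symm.continuous).tendsto 0).comp h1
      have e : ψ.symm 0 = 0 := by rw [← ψ0, ψ.symm_apply_apply, ψ0]
      simpa [Function.comp_def, e] using this
    exact (h2.eventually (gt_mem_nhds hδ)).exists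
  choose m hm using exgood
  let α : ℝ → ℝ × ℝ := fun t => F (m t) t
  have αF : ∀ n t, good n t → α t = F n t := by
    intro n t h
    have h1 := (stepn n t h (max n (m t)) (le_max_left _ _)).2
    have h2 := (stepn (m t) t (hm t).le (max n (m t)) (le_max_right _ _)).2
    exact h2.symm.trans h1
  have Fc : ∀ n, Continuous (F n) := by
    intro n
    exact (g.symm.continuous.iterate _).comp (hk.continuous.comp
      (ψ.symm.continuous.comp (continuous_id.div_const _)))
  have αc : Continuous α := by
    rw [continuous_iff_continuousAt]
    intro t
    have hop : IsOpen {t' : ℝ | |ψ.symm (t' / 4 ^ m t)| < δ} :=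
      isOpen_lt (continuous_abs.comp (ψ.symm.continuous.comp (continuous_id.div_const _)))
        continuous_const
    refine (Fc (m t)).continuousAt.congr ?_
    filter_upwards [hop.mem_nhds (hm t)] with t' ht'
    exact (αF _ _ (le_of_lt ht')).symm
  have αi : Function.Injective α := by
    intro a b hab
    obtain ⟨ga, -⟩ := stepn (m a) a (hm a).le (max (m a) (m b)) (le_max_left _ _)
    obtain ⟨gb, -⟩ := stepn (m b) b (hm b).le (max (m a) (m b)) (le_max_right _ _)
    rw [αF _ _ ga, αF _ _ gb] at hab
    have := ψ.symm.injective (hk.injective ((g.symm.injective.iterate _) hab))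
    have h4 : (4:ℝ) ^ (max (m a) (m b)) ≠ 0 := by positivity
    field_simp at this
    exact this
  have αk : ∀ t, |t| ≤ δ → α (ψ t) = k t := by
    intro t ht
    rw [αF 0 (ψ t) (by simpa [good] using ht)]
    simp [F]
  have αs : ∀ t, s (α t) p := by
    intro t
    rw [← H.s_iter (2 * m t)]
    simp only [α, F, inv]
    exact hks _
  have αg : ∀ t, g (g (α t)) = α (t / 4) := by
    intro t
    obtain ⟨h1, h2⟩ := hg _ (hm t).le
    rw [ψ.apply_symm_apply, div_right_comm] at h1 h2
    rw [αF (m t) (t / 4) h1]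
    simp only [F]
    rw [← h2]
    apply (g.injective.iterate (2 * m t))
    rw [inv, ← Function.iterate_succ_apply, ← Function.iterate_succ_apply,
      Function.iterate_succ_apply', Function.iterate_succ_apply']
    simp only [α, F, inv]
  have αgn : ∀ (n : ℕ) t, g^[2 * n] (α t) = α (t / 4 ^ n) := by
    intro n t
    induction n with
    | zero => simp
    | succ n ih =>
      rw [show 2 * (n + 1) = 2 * n + 1 + 1 by ring, Function.iterate_succ_apply',
        Function.iterate_succ_apply', ih, αg, div_div, ← pow_succ]
  have ent : ∀ x, s x p → ∃ n : ℕ, g^[2 * n] x ∈ N := by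
    intro x hx
    obtain ⟨n, hn⟩ := eventually_atTop.1 ((H.sconv x hx).eventually (hN.mem_nhds hpN))
    exact ⟨n, hn _ (by lia)⟩
  refine ⟨α, αc, αi, ?_, ?_, αg, ?_⟩
  · ext x
    constructor
    · rintro ⟨t, rfl⟩; exact αs t
    · intro hx
      obtain ⟨n, hn⟩ := ent x hx
      obtain ⟨τ, h1, h2⟩ := hNk _ hn ((H.s_iter _ _).2 hx)
      refine ⟨ψ τ * 4 ^ n, ?_⟩
      have e : ψ τ * 4 ^ n / 4 ^ n = ψ τ := by field_simp
      apply (g.injective.iterate (2 * n))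
      rw [αgn, e, αk τ h1, h2]
  · have := αk 0 (by simpa using hδ.le)
    rw [ψ0, hk0] at this; exact this
  · intro C hC
    have loc : ∀ x, ∃ O ∈ 𝓝 x, ∃ M : ℝ, ∀ t, α t ∈ O → |t| ≤ M := by
      intro x
      by_cases hx : s x p
      · obtain ⟨n, hn⟩ := ent x hx
        refine ⟨g^[2 * n] ⁻¹' N, (hN.preimage (g.continuous.iterate _)).mem_nhds hn,
          4 ^ n * max |ψ δ| |ψ (-δ)|, fun t ht => ?_⟩
        obtain ⟨τ, h1, h2⟩ := hNk _ ht ((H.s_iter _ _).2 (αs t))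
        rw [αgn, ← αk τ h1] at h2
        have h3 := αi h2
        have hτ := abs_le.1 h1
        have h4 : |ψ τ| ≤ max |ψ (-δ)| |ψ δ| :=
          abs_le_max_abs_abs (ψ.monotone hτ.1) (ψ.monotone hτ.2)
        have h5 : t = 4 ^ n * ψ τ := by rw [← h3]; field_simp
        rw [h5, abs_mul, abs_of_pos (by positivity : (0:ℝ) < 4 ^ n), max_comm]
        gcongr
      · have : IsClosed {y | s y p} :=
          H.sC.preimage (by fun_prop : Continuous fun y : ℝ × ℝ => (y, p))
        exact ⟨{y | s y p}ᶜ, this.isOpen_compl.mem_nhds hx, 0, fun t ht => absurd (αs t) ht⟩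
    refine hC.induction_on (p := fun C => ∃ M : ℝ, ∀ t, α t ∈ C → |t| ≤ M) ⟨0, by simp⟩ ?_ ?_ ?_
    · rintro A B hAB ⟨M, hM⟩
      exact ⟨M, fun t ht => hM t (hAB ht)⟩
    · rintro A B ⟨M, hM⟩ ⟨M', hM'⟩
      refine ⟨max M M', fun t ht => ?_⟩
      rcases ht with ht | ht
      · exact (hM t ht).trans (le_max_left _ _)
      · exact (hM' t ht).trans (le_max_right _ _)
    · intro x _
      obtain ⟨O, hO, h⟩ := loc x
      exact ⟨O, mem_nhdsWithin_of_mem_nhds hO, h⟩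

end HypData

section Backward
variable {f : Equiv.Perm (ℝ × ℝ)} {U : ℝ × ℝ → ℝ × ℝ → ℝ}

/-- Stable relation: distances never increase. -/
def srel (f : Equiv.Perm (ℝ × ℝ)) (U : ℝ × ℝ → ℝ × ℝ → ℝ) (x y : ℝ × ℝ) : Prop :=
  ∀ n : ℤ, U ((f ^ (n + 1)) x) ((f ^ (n + 1)) y) ≤ U ((f ^ n) x) ((f ^ n) y)

/-- Unstable relation: distances never decrease. -/
def urel (f : Equiv.Perm (ℝ × ℝ)) (U : ℝ × ℝ → ℝ × ℝ → ℝ) (x y : ℝ × ℝ) : Prop :=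
  ∀ n : ℤ, U ((f ^ n) x) ((f ^ n) y) ≤ U ((f ^ (n + 1)) x) ((f ^ (n + 1)) y)

theorem zs (n : ℤ) (x : ℝ × ℝ) : (f ^ (n + 1)) x = f ((f ^ n) x) := by
  rw [add_comm, zpow_add, zpow_one]; rfl

theorem zs' (n : ℤ) (x : ℝ × ℝ) : (f ^ (n + 1)) x = (f ^ n) (f x) := by
  rw [zpow_add, zpow_one]; rfl

theorem zp (x : ℝ × ℝ) (hp : f x = x) (n : ℤ) : (f ^ n) x = x :=
  Function.IsFixedPt.perm_zpow hp n

theorem zc (hf : Continuous f) (hf' : Continuous f.symm) (n : ℤ) : Continuous (f ^ n) := by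
  induction n with
  | zero => simpa using continuous_id
  | succ n ih => exact (hf.comp ih).congr fun x => (zs _ x).symm
  | pred n ih =>
    refine (hf'.comp ih).congr fun x => ?_
    simp only [Function.comp]
    rw [Equiv.symm_apply_eq, ← zs]; simp

theorem conv_step (hU : IsLyapunovMetric f U) (x y : ℝ × ℝ) (n : ℤ) :
    0 ≤ U ((f ^ (n + 1 + 1)) x) ((f ^ (n + 1 + 1)) y) - 2 * U ((f ^ (n + 1)) x) ((f ^ (n + 1)) y)
      + U ((f ^ n) x) ((f ^ n) y) := by
  obtain ⟨-, -, -, h0, -, -, -, hW⟩ := hU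
  by_cases h : x = y
  · subst h
    have e : ∀ z, U z z = 0 := fun z => (h0 z z).2 rfl
    simp [e]
  · have := hW ((f ^ n) x) ((f ^ n) y) (fun h' => h ((f ^ n).injective h'))
    unfold Wd at this
    rw [zs (n + 1), zs (n + 1), zs n, zs n]
    exact this.le

theorem incr_mono (hU : IsLyapunovMetric f U) (x y : ℝ × ℝ) :
    Monotone fun n : ℤ => U ((f ^ (n + 1)) x) ((f ^ (n + 1)) y) - U ((f ^ n) x) ((f ^ n) y) :=
  monotone_int_of_le_succ fun n => by have := conv_step hU x y n; linarith

/-- bounded forward implies stable -/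
theorem srel_of_bdd (hU : IsLyapunovMetric f U) (x y : ℝ × ℝ) (K : ℝ)
    (h : ∀ n : ℤ, 0 ≤ n → U ((f ^ n) x) ((f ^ n) y) ≤ K) : srel f U x y := by
  intro m
  by_contra! hc
  have hm := incr_mono hU x y
  have key : ∀ j : ℕ, U ((f ^ m) x) ((f ^ m) y) +
      j * (U ((f ^ (m + 1)) x) ((f ^ (m + 1)) y) - U ((f ^ m) x) ((f ^ m) y)) ≤
      U ((f ^ (m + j)) x) ((f ^ (m + j)) y) := by
    intro j
    induction j with
    | zero => simp
    | succ j ih =>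
      have := hm (show m ≤ m + j by lia)
      simp only at this
      push_cast
      rw [← add_assoc]
      linarith
  obtain ⟨j, hj⟩ := exists_nat_gt ((K - U ((f ^ m) x) ((f ^ m) y)) /
    (U ((f ^ (m + 1)) x) ((f ^ (m + 1)) y) - U ((f ^ m) x) ((f ^ m) y)))
  rw [div_lt_iff₀ (by linarith)] at hj
  obtain ⟨i, hi⟩ : ∃ i : ℕ, 0 ≤ m + i := ⟨m.natAbs, by omega⟩
  have h1 := key (j + i)
  have h2 := h (m + (j + i : ℕ)) (by push_cast; omega)
  push_cast at h1 h2
  have h3 : (0:ℝ) ≤ (i:ℝ) * (U ((f ^ (m + 1)) x) ((f ^ (m + 1)) y) - U ((f ^ m) x) ((f ^ m) y)) :=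
    mul_nonneg (Nat.cast_nonneg _) (by linarith)
  linarith

theorem urel_of_bdd (hU : IsLyapunovMetric f U) (x y : ℝ × ℝ) (K : ℝ)
    (h : ∀ n : ℤ, n ≤ 0 → U ((f ^ n) x) ((f ^ n) y) ≤ K) : urel f U x y := by
  intro m
  by_contra! hc
  have hm := incr_mono hU x y
  have key : ∀ j : ℕ, U ((f ^ m) x) ((f ^ m) y) +
      j * (U ((f ^ m) x) ((f ^ m) y) - U ((f ^ (m + 1)) x) ((f ^ (m + 1)) y)) ≤
      U ((f ^ (m - j)) x) ((f ^ (m - j)) y) := by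
    intro j
    induction j with
    | zero => simp
    | succ j ih =>
      have := hm (show m - (j + 1) ≤ m by lia)
      simp only at this
      push_cast
      rw [show m - ((j:ℤ) + 1) + 1 = m - j by ring] at this
      linarith
  obtain ⟨j, hj⟩ := exists_nat_gt ((K - U ((f ^ m) x) ((f ^ m) y)) /
    (U ((f ^ m) x) ((f ^ m) y) - U ((f ^ (m + 1)) x) ((f ^ (m + 1)) y)))
  rw [div_lt_iff₀ (by linarith)] at hj
  obtain ⟨i, hi⟩ : ∃ i : ℕ, m - i ≤ 0 := ⟨m.natAbs, by omega⟩
  have h1 := key (j + i)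
  have h2 := h (m - (j + i : ℕ)) (by push_cast; omega)
  push_cast at h1 h2
  have h3 : (0:ℝ) ≤ (i:ℝ) * (U ((f ^ m) x) ((f ^ m) y) - U ((f ^ (m + 1)) x) ((f ^ (m + 1)) y)) :=
    mul_nonneg (Nat.cast_nonneg _) (by linarith)
  linarith

theorem srel_anti {x y : ℝ × ℝ} (h : srel f U x y) :
    Antitone fun n : ℤ => U ((f ^ n) x) ((f ^ n) y) := antitone_int_of_succ_le h

theorem urel_mono {x y : ℝ × ℝ} (h : urel f U x y) :
    Monotone fun n : ℤ => U ((f ^ n) x) ((f ^ n) y) := monotone_int_of_le_succ h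

theorem srel_le {x y : ℝ × ℝ} (h : srel f U x y) (n : ℤ) (hn : 0 ≤ n) :
    U ((f ^ n) x) ((f ^ n) y) ≤ U x y := by simpa using srel_anti h hn

theorem urel_le {x y : ℝ × ℝ} (h : urel f U x y) (n : ℤ) (hn : n ≤ 0) :
    U ((f ^ n) x) ((f ^ n) y) ≤ U x y := by simpa using urel_mono h hn

theorem mem_Ws_iff (hU : IsLyapunovMetric f U) (x y : ℝ × ℝ) : y ∈ Ws f U x ↔ srel f U x y := by
  constructor
  · rintro ⟨K, -, h⟩; exact srel_of_bdd hU x y K h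
  · intro h
    exact ⟨U x y + 1, by linarith [hU.2.1 x y], fun n hn => by linarith [srel_le h n hn]⟩

theorem mem_Wu_iff (hU : IsLyapunovMetric f U) (x y : ℝ × ℝ) : y ∈ Wu f U x ↔ urel f U x y := by
  constructor
  · rintro ⟨K, -, h⟩; exact urel_of_bdd hU x y K h
  · intro h
    exact ⟨U x y + 1, by linarith [hU.2.1 x y], fun n hn => by linarith [urel_le h n hn]⟩

theorem srel_equiv (hU : IsLyapunovMetric f U) : Equivalence (srel f U) where
  refl x n := by rw [(hU.2.2.2.1 _ _).2 rfl, (hU.2.2.2.1 _ _).2 rfl]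
  symm {x y} h n := by rw [hU.2.2.1 _ ((f ^ (n + 1)) x), hU.2.2.1 _ ((f ^ n) x)]; exact h n
  trans {x y z} h1 h2 := srel_of_bdd hU x z (U x y + U y z) fun n hn => by
    have := hU.2.2.2.2.1 ((f ^ n) x) ((f ^ n) y) ((f ^ n) z)
    linarith [srel_le h1 n hn, srel_le h2 n hn]

theorem urel_equiv (hU : IsLyapunovMetric f U) : Equivalence (urel f U) where
  refl x n := by rw [(hU.2.2.2.1 _ _).2 rfl, (hU.2.2.2.1 _ _).2 rfl]
  symm {x y} h n := by rw [hU.2.2.1 _ ((f ^ (n + 1)) x), hU.2.2.1 _ ((f ^ n) x)]; exact h n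
  trans {x y z} h1 h2 := urel_of_bdd hU x z (U x y + U y z) fun n hn => by
    have := hU.2.2.2.2.1 ((f ^ n) x) ((f ^ n) y) ((f ^ n) z)
    linarith [urel_le h1 n hn, urel_le h2 n hn]

theorem U_cont (hU : IsLyapunovMetric f U) (hf : Continuous f) (hf' : Continuous f.symm) (n : ℤ) :
    Continuous fun q : (ℝ × ℝ) × (ℝ × ℝ) => U ((f ^ n) q.1) ((f ^ n) q.2) :=
  hU.1.comp (((zc hf hf' n).comp continuous_fst).prodMk ((zc hf hf' n).comp continuous_snd))

theorem srel_closed (hU : IsLyapunovMetric f U) (hf : Continuous f) (hf' : Continuous f.symm) :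
    IsClosed {q : (ℝ × ℝ) × (ℝ × ℝ) | srel f U q.1 q.2} := by
  have : {q : (ℝ × ℝ) × (ℝ × ℝ) | srel f U q.1 q.2} = ⋂ n : ℤ, {q : (ℝ × ℝ) × (ℝ × ℝ) |
      U ((f ^ (n + 1)) q.1) ((f ^ (n + 1)) q.2) ≤ U ((f ^ n) q.1) ((f ^ n) q.2)} := by
    ext; simp [srel]
  rw [this]
  exact isClosed_iInter fun n => isClosed_le (U_cont hU hf hf' _) (U_cont hU hf hf' _)

theorem urel_closed (hU : IsLyapunovMetric f U) (hf : Continuous f) (hf' : Continuous f.symm) :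
    IsClosed {q : (ℝ × ℝ) × (ℝ × ℝ) | urel f U q.1 q.2} := by
  have : {q : (ℝ × ℝ) × (ℝ × ℝ) | urel f U q.1 q.2} = ⋂ n : ℤ, {q : (ℝ × ℝ) × (ℝ × ℝ) |
      U ((f ^ n) q.1) ((f ^ n) q.2) ≤ U ((f ^ (n + 1)) q.1) ((f ^ (n + 1)) q.2)} := by
    ext; simp [urel]
  rw [this]
  exact isClosed_iInter fun n => isClosed_le (U_cont hU hf hf' _) (U_cont hU hf hf' _)

theorem srel_f (x y : ℝ × ℝ) : srel f U (f x) (f y) ↔ srel f U x y := by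
  constructor
  · intro h n
    have := h (n - 1)
    rw [← zs', ← zs', ← zs', ← zs'] at this
    simpa using this
  · intro h n
    rw [← zs', ← zs', ← zs', ← zs']
    exact h (n + 1)

theorem urel_f (x y : ℝ × ℝ) : urel f U (f x) (f y) ↔ urel f U x y := by
  constructor
  · intro h n
    have := h (n - 1)
    rw [← zs', ← zs', ← zs', ← zs'] at this
    simpa using this
  · intro h n
    rw [← zs', ← zs', ← zs', ← zs']
    exact h (n + 1)

theorem srel_V {x y : ℝ × ℝ} (h : srel f U x y) : Vd f U x y ≤ 0 := by
  have := h 0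
  simp only [zero_add, zpow_one, zpow_zero, Equiv.Perm.coe_one, id] at this
  unfold Vd; linarith

theorem urel_V {x y : ℝ × ℝ} (h : urel f U x y) : 0 ≤ Vd f U x y := by
  have := h 0
  simp only [zero_add, zpow_one, zpow_zero, Equiv.Perm.coe_one, id] at this
  unfold Vd; linarith

theorem V_add_W (x y : ℝ × ℝ) : Vd f U x y + Wd f U x y = Vd f U (f x) (f y) := by
  unfold Vd Wd; ring

theorem su_eq (hU : IsLyapunovMetric f U) (x y : ℝ × ℝ) (h1 : srel f U x y) (h2 : urel f U x y) :
    x = y := by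
  by_contra h
  have hW := hU.2.2.2.2.2.2.2 x y h
  have := V_add_W (f := f) (U := U) x y
  linarith [srel_V ((srel_f x y).2 h1), urel_V h2]

/-- The consequence of condition HP that is used. -/
theorem HP_use (hU : IsLyapunovMetric f U) (hHP : CondHP f U) (C : Set (ℝ × ℝ)) (hC : IsCompact C) :
    ∃ R : ℝ, ∀ x, R < ‖x‖ → ∀ y ∈ C, ∀ z ∈ C,
      Vd f U x z < Vd f U (f x) (f y) ∧ 2 * Vd f U x y - Vd f U (f x) (f y) < Vd f U x z := by
  obtain ⟨R, -, hR⟩ := hHP C hC 1 one_pos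
  obtain ⟨R', hR'⟩ := hC.isBounded.exists_norm_le
  refine ⟨max R R', fun x hx y hy z hz => ?_⟩
  have hxy : x ≠ y := by
    rintro rfl
    have := hR' x hy
    have := (le_max_right R R').trans_lt hx
    linarith
  have h := hR x ((le_max_left _ _).trans_lt hx) y hy z hz
  rw [div_lt_one (hU.2.2.2.2.2.2.2 x y hxy), abs_lt] at h
  have := V_add_W (f := f) (U := U) x y
  constructor <;> linarith

theorem bd_use (hU : IsLyapunovMetric f U) (hHP : CondHP f U) (C : Set (ℝ × ℝ)) (hC : IsCompact C) :
    ∃ R : ℝ, ∀ x, (∃ y ∈ C, srel f U x y) → (∃ z ∈ C, urel f U x z) → ‖x‖ ≤ R := by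
  obtain ⟨R, hR⟩ := HP_use hU hHP C hC
  refine ⟨R, ?_⟩
  rintro x ⟨y, hy, hs⟩ ⟨z, hz, hu⟩
  by_contra! hc
  have := (hR x hc y hy z hz).1
  linarith [srel_V ((srel_f x y).2 hs), urel_V hu]

theorem charts (hU : IsLyapunovMetric f U) (hns : NoSingularities f U) (w : ℝ × ℝ) :
    ∃ h : ℝ × ℝ → ℝ × ℝ, IsOpenEmbedding h ∧ w ∈ range h ∧
    (∀ a b b', srel f U (h (a, b)) (h (a, b'))) ∧ (∀ a a' b, urel f U (h (a, b)) (h (a', b))) := by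
  obtain ⟨h, k, hk, hc, hi, ho, hw, hp⟩ := hns w
  refine ⟨h, .of_continuous_injective_isOpenMap hc hi ho, hw, fun a b b' => ?_, fun a a' b => ?_⟩
  · have : h (a, b') ∈ h '' {q : ℝ × ℝ | q.1 = a} := ⟨(a, b'), rfl, rfl⟩
    rw [(hp a b).1] at this
    exact srel_of_bdd hU _ _ k (connectedComponentIn_subset _ _ this.1)
  · have : h (a', b) ∈ h '' {q : ℝ × ℝ | q.2 = b} := ⟨(a', b), rfl, rfl⟩
    rw [(hp a b).2] at this
    exact urel_of_bdd hU _ _ k (connectedComponentIn_subset _ _ this.1)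

end Backward

section Conv
variable {f : Equiv.Perm (ℝ × ℝ)} {U : ℝ × ℝ → ℝ × ℝ → ℝ}

theorem tendsto_of_U (hU : IsLyapunovMetric f U) {p : ℝ × ℝ} {ι : Type*} {l : Filter ι}
    {x : ι → ℝ × ℝ} (h : Tendsto (fun n => U p (x n)) l (𝓝 0)) : Tendsto x l (𝓝 p) := by
  rw [Metric.tendsto_nhds]
  intro ε hε
  obtain ⟨δ, hδ, hd⟩ := hU.2.2.2.2.2.2.1 p ε hε
  filter_upwards [h.eventually (gt_mem_nhds hδ)] with n hn
  rw [dist_comm]; exact hd _ hn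

theorem acc_lemma (hU : IsLyapunovMetric f U) (hf : Continuous f) (hf' : Continuous f.symm)
    {p y : ℝ × ℝ} (hp : f p = p)
    {l : Filter ℤ} (hl : ∀ j : ℤ, Tendsto (fun n => j + n) l l) {L : ℝ}
    (hL : Tendsto (fun n : ℤ => U p ((f ^ n) y)) l (𝓝 L)) (R : ℝ)
    (hR : ∃ᶠ n in l, ‖(f ^ n) y‖ ≤ R) : L = 0 := by
  have hK : IsCompact (Metric.closedBall (0 : ℝ × ℝ) R) := isCompact_closedBall _ _
  obtain ⟨q, -, hq⟩ := hK.exists_mapClusterPt_of_frequently (l := l) (f := fun n : ℤ => (f ^ n) y)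
    (hR.mono fun n hn => by simpa using hn)
  have key : ∀ j : ℤ, U p ((f ^ j) q) = L := by
    intro j
    have hc : Continuous fun q => U p ((f ^ j) q) :=
      hU.1.comp (continuous_const.prodMk (zc hf hf' j))
    have h1 : MapClusterPt (U p ((f ^ j) q)) l ((fun q => U p ((f ^ j) q)) ∘ fun n : ℤ => (f ^ n) y) :=
      hq.continuousAt_comp (f := fun q => U p ((f ^ j) q)) hc.continuousAt
    have h2 : Tendsto ((fun q => U p ((f ^ j) q)) ∘ fun n : ℤ => (f ^ n) y) l (𝓝 L) := by
      refine (hL.comp (hl j)).congr fun n => ?_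
      simp [Function.comp, zpow_add]
    have : (𝓝 (U p ((f ^ j) q)) ⊓ 𝓝 L).NeBot := h1.neBot.mono (inf_le_inf le_rfl h2)
    exact eq_of_nhds_neBot this
  by_cases hpq : p = q
  · have := key 0
    rw [← hpq] at this
    simp [(hU.2.2.2.1 _ _).2 rfl] at this
    exact this.symm
  · exfalso
    have hW := hU.2.2.2.2.2.2.2 p q hpq
    unfold Wd at hW
    have h0 := key 0
    have h1 := key 1
    have h2 := key 2
    rw [show (2:ℤ) = 1 + 1 by norm_num, zs] at h2
    simp only [zpow_one, zpow_zero, Equiv.Perm.coe_one, id] at h0 h1 h2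
    rw [hp, hp] at hW
    linarith

theorem tl_top (j : ℤ) : Tendsto (fun n : ℤ => j + n) atTop atTop := tendsto_atTop_add_const_left _ _ tendsto_id
theorem tl_bot (j : ℤ) : Tendsto (fun n : ℤ => j + n) atBot atBot := tendsto_atBot_add_const_left _ _ tendsto_id

theorem s_tendsto (hU : IsLyapunovMetric f U) (hB : BothSigns f U) (hHP : CondHP f U)
    (hf : Continuous f) (hf' : Continuous f.symm) {p y : ℝ × ℝ} (hp : f p = p) (hy : srel f U p y) :
    Tendsto (fun n : ℤ => (f ^ n) y) atTop (𝓝 p) := by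
  have hanti : Antitone fun n : ℤ => U p ((f ^ n) y) := by
    have := srel_anti hy; simpa only [zp p hp] using this
  have hL := tendsto_atTop_ciInf hanti ⟨0, by rintro _ ⟨n, rfl⟩; exact hU.2.1 _ _⟩
  by_cases hR : ∃ R, ∃ᶠ n in atTop, ‖(f ^ (n : ℤ)) y‖ ≤ R
  · obtain ⟨R, hR⟩ := hR
    have := acc_lemma hU hf hf' hp tl_top hL R hR
    rw [this] at hL
    exact tendsto_of_U hU hL
  · exfalso
    push Not at hR
    obtain ⟨z, -, hz⟩ := (hB p 1 one_pos).1
    have hs : srel f U p z := by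
      refine srel_of_bdd hU p z (U p z + 2 * U p y) fun M hM => ?_
      lift M to ℕ using hM
      rw [zp p hp]
      have hfin : (insert p ((fun j : ℕ => (f ^ (j : ℤ)) z) '' Iic M)).Finite :=
        ((finite_Iic M).image _).insert p
      obtain ⟨R, hRR⟩ := HP_use hU hHP _ hfin.isCompact
      obtain ⟨N₀, hN₀⟩ := eventually_atTop.1 (hR R)
      obtain ⟨N, hN1, hN2⟩ : ∃ N : ℤ, N₀ ≤ N ∧ 0 ≤ N := ⟨max N₀ 0, le_max_left _ _, le_max_right _ _⟩
      have ind : ∀ j : ℕ, j ≤ M → U ((f ^ (N + j)) y) ((f ^ (j : ℤ)) z) ≤ U ((f ^ N) y) z := by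
        intro j
        induction j with
        | zero => intro _; simp
        | succ j ih =>
          intro hj
          have ih := ih (by omega)
          have h1 := (hRR ((f ^ (N + j)) y) (hN₀ _ (by omega)) p (mem_insert _ _) ((f ^ (j : ℤ)) z)
            (mem_insert_of_mem _ ⟨j, by simp; omega, rfl⟩)).1
          have h2 : srel f U (f ((f ^ (N + j)) y)) (f p) := by
            rw [srel_f, ← zp p hp (N + j)]
            refine srel_of_bdd hU _ _ (U p y) fun n hn => ?_
            rw [zp p hp, zp p hp, hU.2.2.1, ← Equiv.Perm.mul_apply, ← zpow_add]
            simpa using hanti (show 0 ≤ n + (N + j) by omega)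
          have h3 := srel_V h2
          unfold Vd at h1 h3
          push_cast
          rw [← add_assoc, zs, zs]
          linarith
      have h1 := ind M le_rfl
      have h2 := hU.2.2.2.2.1 p ((f ^ (N + M)) y) ((f ^ (M : ℤ)) z)
      have h3 := hU.2.2.2.2.1 ((f ^ N) y) p z
      have h4 : U p ((f ^ (N + M)) y) ≤ U p y := by simpa using hanti (show 0 ≤ N + M by omega)
      have h5 : U p ((f ^ N) y) ≤ U p y := by simpa using hanti hN2
      rw [hU.2.2.1 _ p] at h3
      linarith
    linarith [srel_V hs]

theorem u_tendsto (hU : IsLyapunovMetric f U) (hB : BothSigns f U) (hHP : CondHP f U)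
    (hf : Continuous f) (hf' : Continuous f.symm) {p y : ℝ × ℝ} (hp : f p = p) (hy : urel f U p y) :
    Tendsto (fun n : ℤ => (f ^ n) y) atBot (𝓝 p) := by
  have hmono : Monotone fun n : ℤ => U p ((f ^ n) y) := by
    have := urel_mono hy; simpa only [zp p hp] using this
  have hL := tendsto_atBot_ciInf hmono ⟨0, by rintro _ ⟨n, rfl⟩; exact hU.2.1 _ _⟩
  by_cases hR : ∃ R, ∃ᶠ n in atBot, ‖(f ^ (n : ℤ)) y‖ ≤ R
  · obtain ⟨R, hR⟩ := hR
    have := acc_lemma hU hf hf' hp tl_bot hL R hR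
    rw [this] at hL
    exact tendsto_of_U hU hL
  · exfalso
    push Not at hR
    obtain ⟨z, -, hz⟩ := (hB p 1 one_pos).2
    have hs : urel f U p z := by
      refine urel_of_bdd hU p z (U p z + 3 * U p y) fun M' hM' => ?_
      obtain ⟨M, rfl⟩ : ∃ M : ℕ, M' = - (M : ℤ) := ⟨M'.natAbs, by omega⟩
      rw [zp p hp]
      have hfin : (insert p ((fun j : ℕ => (f ^ (-(j : ℤ))) z) '' Iic M)).Finite :=
        ((finite_Iic M).image _).insert p
      obtain ⟨R, hRR⟩ := HP_use hU hHP _ hfin.isCompact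
      obtain ⟨N₀, hN₀⟩ := eventually_atBot.1 (hR R)
      obtain ⟨N, hN1, hN2⟩ : ∃ N : ℤ, N ≤ N₀ ∧ N ≤ -1 := ⟨min N₀ (-1), min_le_left _ _, min_le_right _ _⟩
      have ind : ∀ j : ℕ, j ≤ M → U ((f ^ (N - j)) y) ((f ^ (-(j : ℤ))) z) ≤
          U ((f ^ N) y) z + U p ((f ^ (N + 1)) y) - U p ((f ^ (N - j + 1)) y) := by
        intro j
        induction j with
        | zero => intro _; simp
        | succ j ih =>
          intro hj
          have ih := ih (by omega)
          have h1 := (hRR ((f ^ (N - (j + 1 : ℕ))) y) (hN₀ _ (by omega)) p (mem_insert _ _)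
            ((f ^ (-((j + 1 : ℕ) : ℤ))) z) (mem_insert_of_mem _ ⟨j + 1, by simp; omega, rfl⟩)).2
          unfold Vd at h1
          rw [hp, hp] at h1
          rw [← zs, ← zs, ← zs] at h1
          push_cast at h1 ⊢
          rw [show N - ((j : ℤ) + 1) + 1 = N - j by ring, show -((j : ℤ) + 1) + 1 = - j by ring,
            hU.2.2.1 _ p, hU.2.2.1 _ p, hU.2.2.1 _ p] at h1
          rw [show N - ((j : ℤ) + 1) + 1 = N - j by ring]
          have h2 : U p ((f ^ (N - (j + 1))) y) ≤ U p ((f ^ (N - j)) y) := hmono (by omega)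
          linarith
      have h1 := ind M le_rfl
      have h2 := hU.2.2.2.2.1 p ((f ^ (N - M)) y) ((f ^ (-(M : ℤ))) z)
      have h3 := hU.2.2.2.2.1 ((f ^ N) y) p z
      have h4 : U p ((f ^ (N - M)) y) ≤ U p y := by simpa using hmono (show N - M ≤ 0 by omega)
      have h5 : U p ((f ^ N) y) ≤ U p y := by simpa using hmono (show N ≤ 0 by omega)
      have h6 : U p ((f ^ (N + 1)) y) ≤ U p y := by simpa using hmono (show N + 1 ≤ 0 by omega)
      have h7 := hU.2.1 p ((f ^ (N - M + 1)) y)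
      rw [hU.2.2.1 _ p] at h3
      linarith
    linarith [urel_V hs]

theorem iter_eq (n : ℕ) (x : ℝ × ℝ) : f^[n] x = (f ^ (n : ℤ)) x := by
  rw [zpow_natCast, Equiv.Perm.coe_pow]

theorem iter_eq' (n : ℕ) (x : ℝ × ℝ) : f.symm^[n] x = (f ^ (-(n : ℤ))) x := by
  have : (f ^ (-(n : ℤ))) = f.symm ^ n := by
    rw [zpow_neg, zpow_natCast, ← inv_pow]; rfl
  rw [this, Equiv.Perm.coe_pow]

/-- The homeomorphism built from `f`. -/
def homeoOf (f : Equiv.Perm (ℝ × ℝ)) (hf : Continuous f) (hf' : Continuous f.symm) :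
    ℝ × ℝ ≃ₜ ℝ × ℝ where
  toEquiv := f
  continuous_toFun := hf
  continuous_invFun := hf'

theorem hypData (hU : IsLyapunovMetric f U) (hB : BothSigns f U) (hHP : CondHP f U)
    (hns : NoSingularities f U)
    (hf : Continuous f) (hf' : Continuous f.symm) {p : ℝ × ℝ} (hp : f p = p) :
    HypData (homeoOf f hf hf') p (srel f U) (urel f U) where
  sE := srel_equiv hU
  uE := urel_equiv hU
  sC := srel_closed hU hf hf'
  uC := urel_closed hU hf hf'
  sg := srel_f
  ug := urel_f
  su := su_eq hU
  bd := bd_use hU hHP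
  ch := charts hU hns
  gp := hp
  sconv x hx := by
    have := s_tendsto hU hB hHP hf hf' hp ((srel_equiv hU).symm hx)
    exact (this.comp tendsto_natCast_atTop_atTop).congr fun n => (iter_eq n x).symm
  uconv x hx := by
    have := u_tendsto hU hB hHP hf hf' hp ((urel_equiv hU).symm hx)
    exact (this.comp (tendsto_neg_atTop_atBot.comp tendsto_natCast_atTop_atTop)).congr
      fun n => (iter_eq' n x).symm
  sstab N hN := by
    obtain ⟨ε, hε, hN⟩ := Metric.mem_nhds_iff.1 hN
    obtain ⟨δ, hδ, hd⟩ := hU.2.2.2.2.2.2.1 p ε hε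
    obtain ⟨δ', hδ', hd'⟩ := hU.2.2.2.2.2.1 p δ hδ
    refine ⟨_, Metric.ball_mem_nhds p hδ', fun x hx hs n => hN ?_⟩
    rw [Metric.mem_ball, dist_comm] at hx ⊢
    refine hd _ (lt_of_le_of_lt ?_ (hd' x hx))
    have := srel_le ((srel_equiv hU).symm hs) n (by omega)
    rw [zp p hp, ← iter_eq] at this
    exact this
  ustab N hN := by
    obtain ⟨ε, hε, hN⟩ := Metric.mem_nhds_iff.1 hN
    obtain ⟨δ, hδ, hd⟩ := hU.2.2.2.2.2.2.1 p ε hε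
    obtain ⟨δ', hδ', hd'⟩ := hU.2.2.2.2.2.1 p δ hδ
    refine ⟨_, Metric.ball_mem_nhds p hδ', fun x hx hs n => hN ?_⟩
    rw [Metric.mem_ball, dist_comm] at hx ⊢
    refine hd _ (lt_of_le_of_lt ?_ (hd' x hx))
    have := urel_le ((urel_equiv hU).symm hs) (-n) (by omega)
    rw [zp p hp, ← iter_eq'] at this
    exact this
end Conv

section BackwardMain

theorem one_dim (A : ℝ → ℝ) (hA : Continuous A) (hi : Function.Injective A) (h0 : A 0 = 0)
    (h1 : 0 < A 1) (c : ℝ) (hc : 0 < c) : ∃ ψ : ℝ ≃ₜ ℝ, ∀ t, ψ t = A t + c * t := by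
  have hm : StrictMono A := by
    rcases hA.strictMono_of_inj hi with h | h
    · exact h
    · have := h (zero_lt_one' ℝ); linarith
  have hm' : StrictMono fun t => A t + c * t := fun a b hab => by
    have := hm hab
    have := mul_lt_mul_of_pos_left hab hc
    simp only; linarith
  have hcont : Continuous fun t => A t + c * t := by fun_prop
  have hs : Function.Surjective fun t => A t + c * t := by
    intro y
    have e : ∀ y : ℝ, c * (y / c) = y := fun y => by field_simp
    refine mem_range_of_exists_le_of_exists_ge hcont ⟨min 0 (y / c), ?_⟩ ⟨max 0 (y / c), ?_⟩
    · have h2 := hm.monotone (min_le_left 0 (y / c))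
      have h3 := mul_le_mul_of_nonneg_left (min_le_right 0 (y / c)) hc.le
      rw [e] at h3; linarith
    · have h2 := hm.monotone (le_max_left 0 (y / c))
      have h3 := mul_le_mul_of_nonneg_left (le_max_right 0 (y / c)) hc.le
      rw [e] at h3; linarith
  exact ⟨(StrictMono.orderIsoOfSurjective _ hm' hs).toHomeomorph, fun t => rfl⟩

theorem pos_of_preconn {S : Set (ℝ × ℝ)} (hS : IsPreconnected S) {φ : ℝ × ℝ → ℝ}
    (hφ : Continuous φ) (h0 : ∀ x ∈ S, φ x ≠ 0) {q r : ℝ × ℝ} (hq : q ∈ S) (hr : r ∈ S)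
    (h : 0 < φ q) : 0 < φ r := by
  by_contra! hc
  have := (hS.image φ hφ.continuousOn).ordConnected.out ⟨r, hr, rfl⟩ ⟨q, hq, rfl⟩ ⟨hc, h.le⟩
  obtain ⟨x, hx, hx0⟩ := this
  exact h0 x hx hx0

theorem backward {f : Equiv.Perm (ℝ × ℝ)} {U : ℝ × ℝ → ℝ × ℝ → ℝ}
    (hU : IsLyapunovMetric f U) (hB : BothSigns f U) (hHP : CondHP f U)
    (hns : NoSingularities f U)
    (hf : Continuous f) (hf' : Continuous f.symm) {p : ℝ × ℝ} (hp : f p = p)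
    (hQ : QuadrantsInvariant f U p) : ∃ l : ℝ, 1 < l ∧ ∃ h : ℝ × ℝ ≃ₜ ℝ × ℝ,
      ∀ z : ℝ × ℝ, h (f z) = (l * (h z).1, l⁻¹ * (h z).2) := by
  have H := hypData hU hB hHP hns hf hf' hp
  obtain ⟨β, hβ, hβi, hβr, hβ0, hβg, hβp⟩ := H.exists_arc
  obtain ⟨α, hα, hαi, hαr, hα0, hαg, hαp⟩ := H.swap.exists_arc
  obtain ⟨Φ, hΦ⟩ := H.exists_homeo hα hβ hαi hβi hα0 hβ0 hαr hβr hαp hβp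
  have hαu : ∀ a, urel f U (α a) p := fun a => by
    have : α a ∈ {x | urel f U x p} := hαr ▸ mem_range_self a
    exact this
  have hβs : ∀ a, srel f U (β a) p := fun a => by
    have : β a ∈ {x | srel f U x p} := hβr ▸ mem_range_self a
    exact this
  have hA : ∀ a, ∃ a', α a' = f (α a) := fun a => by
    have : f (α a) ∈ {x | urel f U x p} := by
      have := (urel_f (U := U) _ _).2 (hαu a)
      rwa [hp] at this
    rwa [← hαr] at this
  have hB : ∀ a, ∃ a', β a' = f (β a) := fun a => by
    have : f (β a) ∈ {x | srel f U x p} := by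
      have := (srel_f (U := U) _ _).2 (hβs a)
      rwa [hp] at this
    rwa [← hβr] at this
  choose A hA using hA
  choose B hB using hB
  have hfΦ : ∀ a b, f (Φ (a, b)) = Φ (A a, B b) := fun a b => by
    refine H.uniq (y := α (A a)) (z := β (B b)) ?_ ?_ (hΦ _ _).1 (hΦ _ _).2
    · rw [hA, srel_f]; exact (hΦ a b).1
    · rw [hB, urel_f]; exact (hΦ a b).2
  have sE := srel_equiv hU
  have uE := urel_equiv hU
  have hs0 : ∀ a b, srel f U p (Φ (a, b)) ↔ a = 0 := fun a b => by
    constructor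
    · intro h
      apply hαi
      rw [hα0]
      exact su_eq hU _ _ (sE.trans (sE.symm (hΦ a b).1) (sE.symm h)) (hαu a)
    · rintro rfl
      have := (hΦ 0 b).1
      rw [hα0] at this
      exact sE.symm this
  have hu0 : ∀ a b, urel f U p (Φ (a, b)) ↔ b = 0 := fun a b => by
    constructor
    · intro h
      apply hβi
      rw [hβ0]
      exact su_eq hU _ _ (hβs b) (uE.trans (uE.symm (hΦ a b).2) (uE.symm h))
    · rintro rfl
      have := (hΦ a 0).2
      rw [hβ0] at this
      exact uE.symm this
  have hAc : Continuous A := by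
    have : Continuous fun a : ℝ => (Φ.symm (f (Φ (a, 0)))).1 := by fun_prop
    refine this.congr fun a => ?_
    rw [hfΦ]; simp
  have hBc : Continuous B := by
    have : Continuous fun a : ℝ => (Φ.symm (f (Φ (0, a)))).2 := by fun_prop
    refine this.congr fun a => ?_
    rw [hfΦ]; simp
  have hAi : Function.Injective A := fun a b h => by
    apply hαi; apply f.injective; rw [← hA, ← hA, h]
  have hBi : Function.Injective B := fun a b h => by
    apply hβi; apply f.injective; rw [← hB, ← hB, h]
  have hA0 : A 0 = 0 := by apply hαi; rw [hA, hα0, hp]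
  have hB0 : B 0 = 0 := by apply hβi; rw [hB, hβ0, hp]
  have hAA : ∀ a, A (A a) = 4 * a := fun a => by
    apply hαi
    have h1 : f.symm (f.symm (α (4 * a))) = α (4 * a / 4) := hαg (4 * a)
    rw [show 4 * a / 4 = a by ring] at h1
    rw [hA, hA, ← h1]; simp
  have hBB : ∀ a, B (B a) = a / 4 := fun a => by
    apply hβi
    rw [hB, hB]; exact hβg a
  have hcompl : ∀ x ∈ (Ws f U p ∪ Wu f U p)ᶜ, (Φ.symm x).1 ≠ 0 ∧ (Φ.symm x).2 ≠ 0 := by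
    intro x hx
    obtain ⟨⟨a, b⟩, rfl⟩ := Φ.surjective x
    simp only [mem_compl_iff, mem_union, mem_Ws_iff hU, mem_Wu_iff hU, hs0, hu0, not_or] at hx
    simpa using hx
  have hq : Φ (1, 1) ∉ Ws f U p ∪ Wu f U p := by
    simp [mem_union, mem_Ws_iff hU, mem_Wu_iff hU, hs0, hu0]
  have hQ1 := hQ _ hq
  set S := connectedComponentIn (Ws f U p ∪ Wu f U p)ᶜ (Φ (1, 1)) with hS
  have hqS : Φ (1, 1) ∈ S := mem_connectedComponentIn hq
  have hrS : Φ (A 1, B 1) ∈ S := by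
    rw [← hfΦ, ← hQ1]; exact mem_image_of_mem _ hqS
  have hsub : S ⊆ (Ws f U p ∪ Wu f U p)ᶜ := connectedComponentIn_subset _ _
  have hA1 : 0 < A 1 := by
    have := pos_of_preconn (φ := fun x => (Φ.symm x).1) isPreconnected_connectedComponentIn
      (by fun_prop) (fun x hx => (hcompl x (hsub hx)).1) hqS hrS (by simp)
    simpa using this
  have hB1 : 0 < B 1 := by
    have := pos_of_preconn (φ := fun x => (Φ.symm x).2) isPreconnected_connectedComponentIn
      (by fun_prop) (fun x hx => (hcompl x (hsub hx)).2) hqS hrS (by simp)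
    simpa using this
  obtain ⟨ψA, hψA⟩ := one_dim A hAc hAi hA0 hA1 2 two_pos
  obtain ⟨ψB, hψB⟩ := one_dim B hBc hBi hB0 hB1 (1/2) one_half_pos
  refine ⟨2, one_lt_two, Φ.symm.trans (ψA.prodCongr ψB), fun z => ?_⟩
  obtain ⟨⟨a, b⟩, rfl⟩ := Φ.surjective z
  rw [hfΦ]
  simp only [Homeomorph.trans_apply, Homeomorph.symm_apply_apply, Homeomorph.coe_prodCongr,
    Prod.map_apply, hψA, hψB, hAA, hBB, Prod.mk.injEq]
  constructor <;> ring

end BackwardMain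

section Forward

/-- The model metric. -/
def modelU (h : ℝ × ℝ ≃ₜ ℝ × ℝ) (x y : ℝ × ℝ) : ℝ :=
  |(h x).1 - (h y).1| + |(h x).2 - (h y).2|

variable {f : Equiv.Perm (ℝ × ℝ)} {l : ℝ} {h : ℝ × ℝ ≃ₜ ℝ × ℝ}

theorem modelU_f (hl : 1 < l) (hh : ∀ z : ℝ × ℝ, h (f z) = (l * (h z).1, l⁻¹ * (h z).2))
    (x y : ℝ × ℝ) : modelU h (f x) (f y) =
      l * |(h x).1 - (h y).1| + l⁻¹ * |(h x).2 - (h y).2| := by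
  have h0 : 0 < l := by linarith
  unfold modelU
  rw [hh, hh]
  simp only
  rw [← mul_sub, ← mul_sub, abs_mul, abs_mul, abs_of_pos h0, abs_of_pos (inv_pos.2 h0)]

theorem model_V (hl : 1 < l) (hh : ∀ z : ℝ × ℝ, h (f z) = (l * (h z).1, l⁻¹ * (h z).2))
    (x y : ℝ × ℝ) : Vd f (modelU h) x y =
      (l - 1) * |(h x).1 - (h y).1| - (1 - l⁻¹) * |(h x).2 - (h y).2| := by
  unfold Vd
  rw [modelU_f hl hh, modelU]; ring

theorem model_W (hl : 1 < l) (hh : ∀ z : ℝ × ℝ, h (f z) = (l * (h z).1, l⁻¹ * (h z).2))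
    (x y : ℝ × ℝ) : Wd f (modelU h) x y =
      (l - 1) ^ 2 * |(h x).1 - (h y).1| + (1 - l⁻¹) ^ 2 * |(h x).2 - (h y).2| := by
  have h0 : 0 < l := by linarith
  unfold Wd
  rw [modelU_f hl hh, modelU_f hl hh, modelU, hh, hh]
  simp only
  rw [← mul_sub, ← mul_sub, abs_mul, abs_mul, abs_of_pos h0, abs_of_pos (inv_pos.2 h0)]
  ring

theorem modelU_zpow (hl : 1 < l) (hh : ∀ z : ℝ × ℝ, h (f z) = (l * (h z).1, l⁻¹ * (h z).2))
    (n : ℤ) (x : ℝ × ℝ) : h ((f ^ n) x) = (l ^ n * (h x).1, (l ^ n)⁻¹ * (h x).2) := by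
  have h0 : l ≠ 0 := by linarith
  induction n with
  | zero => simp
  | succ n ih =>
    rw [zs, hh, ih, zpow_add_one₀ h0, mul_inv]
    ext <;> simp only <;> ring
  | pred n ih =>
    have h1 := hh ((f ^ (-(n:ℤ) - 1)) x)
    rw [← zs, show -(n:ℤ) - 1 + 1 = -n by ring, ih, Prod.ext_iff] at h1
    simp only at h1
    rw [zpow_sub_one₀ h0, mul_inv, inv_inv]
    ext
    · simp only
      field_simp
      linarith [h1.1]
    · simp only
      have := h1.2
      rw [mul_right_comm, this]
      field_simp

theorem modelU_n (hl : 1 < l) (hh : ∀ z : ℝ × ℝ, h (f z) = (l * (h z).1, l⁻¹ * (h z).2))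
    (n : ℤ) (x y : ℝ × ℝ) : modelU h ((f ^ n) x) ((f ^ n) y) =
      l ^ n * |(h x).1 - (h y).1| + (l ^ n)⁻¹ * |(h x).2 - (h y).2| := by
  have h0 : 0 < l ^ n := zpow_pos (by linarith) n
  unfold modelU
  rw [modelU_zpow hl hh, modelU_zpow hl hh]
  simp only
  rw [← mul_sub, ← mul_sub, abs_mul, abs_mul, abs_of_pos h0, abs_of_pos (inv_pos.2 h0)]

theorem zero_of_pow_bdd (hl : 1 < l) {d K : ℝ} (hd : 0 ≤ d) (hK : ∀ n : ℕ, l ^ n * d ≤ K) : d = 0 := by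
  by_contra hne
  have hd : 0 < d := lt_of_le_of_ne hd (Ne.symm hne)
  obtain ⟨n, hn⟩ := pow_unbounded_of_one_lt (K / d) hl
  rw [div_lt_iff₀ hd] at hn
  linarith [hK n]

theorem model_s (hl : 1 < l) (hh : ∀ z : ℝ × ℝ, h (f z) = (l * (h z).1, l⁻¹ * (h z).2))
    (x y : ℝ × ℝ) (K : ℝ) :
    (∀ n : ℤ, 0 ≤ n → modelU h ((f ^ n) x) ((f ^ n) y) ≤ K) ↔
      (h x).1 = (h y).1 ∧ |(h x).2 - (h y).2| ≤ K := by
  constructor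
  · intro H
    have h1 : (h x).1 = (h y).1 := by
      have := zero_of_pow_bdd hl (abs_nonneg ((h x).1 - (h y).1)) (K := K) fun n => by
        have := H n (by omega)
        rw [modelU_n hl hh] at this
        have h2 : 0 ≤ (l ^ (n:ℤ))⁻¹ * |(h x).2 - (h y).2| :=
          mul_nonneg (inv_nonneg.2 (zpow_nonneg (by linarith) _)) (abs_nonneg _)
        rw [zpow_natCast] at *
        linarith
      linarith [abs_eq_zero.1 this]
    refine ⟨h1, ?_⟩
    have := H 0 le_rfl
    rw [modelU_n hl hh, h1] at this
    simpa using this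
  · rintro ⟨h1, h2⟩ n hn
    rw [modelU_n hl hh, h1]
    have : (l ^ n)⁻¹ ≤ 1 := inv_le_one_of_one_le₀ (one_le_zpow₀ hl.le hn)
    have := mul_le_mul_of_nonneg_right this (abs_nonneg ((h x).2 - (h y).2))
    simp; linarith

theorem model_u (hl : 1 < l) (hh : ∀ z : ℝ × ℝ, h (f z) = (l * (h z).1, l⁻¹ * (h z).2))
    (x y : ℝ × ℝ) (K : ℝ) :
    (∀ n : ℤ, n ≤ 0 → modelU h ((f ^ n) x) ((f ^ n) y) ≤ K) ↔
      (h x).2 = (h y).2 ∧ |(h x).1 - (h y).1| ≤ K := by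
  constructor
  · intro H
    have h1 : (h x).2 = (h y).2 := by
      have := zero_of_pow_bdd hl (abs_nonneg ((h x).2 - (h y).2)) (K := K) fun n => by
        have := H (-n) (by omega)
        rw [modelU_n hl hh] at this
        have h2 : 0 ≤ (l ^ (-n:ℤ)) * |(h x).1 - (h y).1| :=
          mul_nonneg (zpow_nonneg (by linarith) _) (abs_nonneg _)
        rw [zpow_neg, inv_inv, zpow_natCast] at *
        linarith
      linarith [abs_eq_zero.1 this]
    refine ⟨h1, ?_⟩
    have := H 0 le_rfl
    rw [modelU_n hl hh, h1] at this
    simpa using this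
  · rintro ⟨h1, h2⟩ n hn
    rw [modelU_n hl hh, h1]
    have : (l ^ n) ≤ 1 := zpow_le_one_of_nonpos₀ hl.le hn
    have := mul_le_mul_of_nonneg_right this (abs_nonneg ((h x).1 - (h y).1))
    simp; linarith

theorem model_lyap (hl : 1 < l) (hh : ∀ z : ℝ × ℝ, h (f z) = (l * (h z).1, l⁻¹ * (h z).2)) :
    IsLyapunovMetric f (modelU h) := by
  have hc : Continuous (fun z : (ℝ × ℝ) × (ℝ × ℝ) => modelU h z.1 z.2) := by
    unfold modelU; fun_prop
  have hne : ∀ x y : ℝ × ℝ, x ≠ y → 0 < |(h x).1 - (h y).1| ∨ 0 < |(h x).2 - (h y).2| := by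
    intro x y hxy
    by_contra! hcon
    apply hxy
    apply h.injective
    ext
    · linarith [abs_eq_zero.1 (le_antisymm hcon.1 (abs_nonneg _))]
    · linarith [abs_eq_zero.1 (le_antisymm hcon.2 (abs_nonneg _))]
  refine ⟨hc, ?_, ?_, ?_, ?_, ?_, ?_, ?_⟩
  · intro x y; unfold modelU; positivity
  · intro x y; unfold modelU; rw [abs_sub_comm, abs_sub_comm (h x).2]
  · intro x y
    constructor
    · intro h0
      by_contra hxy
      unfold modelU at h0
      rcases hne x y hxy with h1 | h1
      · linarith [abs_nonneg ((h x).2 - (h y).2)]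
      · linarith [abs_nonneg ((h x).1 - (h y).1)]
    · rintro rfl; simp [modelU]
  · intro x y z
    unfold modelU
    linarith [abs_sub_le (h x).1 (h y).1 (h z).1, abs_sub_le (h x).2 (h y).2 (h z).2]
  · intro x ε hε
    have hcx : Continuous fun y => modelU h x y := hc.comp (continuous_const.prodMk continuous_id)
    obtain ⟨δ, hδ, H⟩ := Metric.continuous_iff.1 hcx x ε hε
    refine ⟨δ, hδ, fun y hy => ?_⟩
    have := H y (by rwa [dist_comm])
    rw [Real.dist_eq] at this
    have h0 : modelU h x x = 0 := by simp [modelU]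
    rw [h0, sub_zero] at this
    exact (le_abs_self _).trans_lt this
  · intro x ε hε
    obtain ⟨δ, hδ, H⟩ := Metric.continuous_iff.1 h.symm.continuous (h x) ε hε
    refine ⟨δ, hδ, fun y hy => ?_⟩
    have := H (h y) (by
      rw [dist_comm, Prod.dist_eq, Real.dist_eq, Real.dist_eq]
      unfold modelU at hy
      refine max_lt ?_ ?_
      · linarith [abs_nonneg ((h x).2 - (h y).2)]
      · linarith [abs_nonneg ((h x).1 - (h y).1)])
    simpa [dist_comm] using this
  · intro x y hxy
    rw [model_W hl hh]
    have h1 : 0 < (l - 1) ^ 2 := pow_pos (by linarith) 2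
    have h2 : 0 < (1 - l⁻¹) ^ 2 := pow_pos (by linarith [inv_lt_one_of_one_lt₀ hl]) 2
    rcases hne x y hxy with h3 | h3
    · have := mul_pos h1 h3
      positivity
    · have := mul_pos h2 h3
      positivity

theorem preconn_of_convex {S : Set (ℝ × ℝ)} (T : Set (ℝ × ℝ)) (hT : IsPreconnected T)
    (hS : ∀ x, x ∈ S ↔ h x ∈ T) : IsPreconnected S := by
  have : S = h.symm '' T := by
    rw [Homeomorph.image_symm]; ext x; exact hS x
  rw [this]
  exact hT.image _ h.symm.continuous.continuousOn

theorem model_Bk (k : ℝ) (hk : 0 < k) (x : ℝ × ℝ) :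
    Bk (modelU h) k x = {w | modelU h x w ≤ k} := by
  refine IsPreconnected.connectedComponentIn ?_ (by simp [modelU, hk.le])
  refine preconn_of_convex (h := h) {w | |(h x).1 - w.1| + |(h x).2 - w.2| ≤ k} ?_ fun y => Iff.rfl
  refine Convex.isPreconnected ?_
  intro v hv w hw s t hs ht hst
  simp only [mem_ofPred_eq, Prod.fst_add, Prod.snd_add, Prod.smul_fst, Prod.smul_snd, smul_eq_mul] at *
  have e : ∀ a b c : ℝ, |a - (s * b + t * c)| ≤ s * |a - b| + t * |a - c| := fun a b c => by
    have : a - (s * b + t * c) = s * (a - b) + t * (a - c) := by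
      linear_combination (-a) * hst
    rw [this]
    refine (abs_add_le _ _).trans ?_
    rw [abs_mul, abs_mul, abs_of_nonneg hs, abs_of_nonneg ht]
  have h1 := e (h x).1 v.1 w.1
  have h2 := e (h x).2 v.2 w.2
  have h3 := mul_le_mul_of_nonneg_left hv hs
  have h4 := mul_le_mul_of_nonneg_left hw ht
  have h5 : s * k + t * k = k := by rw [← add_mul, hst, one_mul]
  linarith

theorem model_front (k : ℝ) (hk : 0 < k) (x : ℝ × ℝ) (c : ℝ → ℝ × ℝ) (hc : Continuous c)
    (hck : ∀ t, 0 < t → modelU h x (c t) = t) : c k ∈ frontier (Bk (modelU h) k x) := by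
  rw [model_Bk k hk, frontier, Set.mem_sdiff]
  refine ⟨subset_closure (hck k hk).le, fun hi => ?_⟩
  have ho : IsOpen (c ⁻¹' interior {w | modelU h x w ≤ k}) := isOpen_interior.preimage hc
  have hsub : c ⁻¹' interior {w | modelU h x w ≤ k} ⊆ Iic k := by
    intro t ht
    by_contra hn
    simp only [mem_Iic, not_le] at hn
    have : modelU h x (c t) ≤ k := interior_subset (s := {w | modelU h x w ≤ k}) ht
    rw [hck t (hk.trans hn)] at this
    linarith
  have := interior_maximal hsub ho hi
  rw [interior_Iic] at this
  exact lt_irrefl k (mem_Iio.1 this)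

theorem model_both (hl : 1 < l) (hh : ∀ z : ℝ × ℝ, h (f z) = (l * (h z).1, l⁻¹ * (h z).2)) :
    BothSigns f (modelU h) := by
  intro x k hk
  have h2 : 0 < 1 - l⁻¹ := by linarith [inv_lt_one_of_one_lt₀ hl]
  constructor
  · refine ⟨_, model_front k hk x (fun t => h.symm ((h x).1 + t, (h x).2)) (by fun_prop) ?_, ?_⟩
    · intro t ht; simp [modelU, abs_of_pos ht]
    · rw [model_V hl hh]
      simp only [Homeomorph.apply_symm_apply, sub_add_cancel_left, abs_neg, abs_of_pos hk, sub_self,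
        abs_zero, mul_zero, sub_zero]
      exact mul_pos (by linarith) hk
  · refine ⟨_, model_front k hk x (fun t => h.symm ((h x).1, (h x).2 + t)) (by fun_prop) ?_, ?_⟩
    · intro t ht; simp [modelU, abs_of_pos ht]
    · rw [model_V hl hh]
      simp only [Homeomorph.apply_symm_apply, sub_add_cancel_left, abs_neg, abs_of_pos hk, sub_self,
        abs_zero, mul_zero, zero_sub]
      linarith [mul_pos h2 hk]

theorem model_HP (hl : 1 < l) (hh : ∀ z : ℝ × ℝ, h (f z) = (l * (h z).1, l⁻¹ * (h z).2)) :
    CondHP f (modelU h) := by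
  intro C hC ε hε
  obtain ⟨M, hM⟩ := (hC.image h.continuous).isBounded.exists_norm_le
  have hM1 : ∀ y ∈ C, |(h y).1| ≤ |M| ∧ |(h y).2| ≤ |M| := fun y hy => by
    have h1 := hM _ (mem_image_of_mem h hy)
    exact ⟨((norm_fst_le _).trans h1).trans (le_abs_self _),
      ((norm_snd_le _).trans h1).trans (le_abs_self _)⟩
  set N := |M| with hN
  have hN0 : 0 ≤ N := abs_nonneg _
  have ha : 0 < l - 1 := by linarith
  have hb : 0 < 1 - l⁻¹ := by linarith [inv_lt_one_of_one_lt₀ hl]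
  have hba : 1 - l⁻¹ ≤ l - 1 := by
    have h0 : 0 < l := by linarith
    have h1 : l * l⁻¹ = 1 := mul_inv_cancel₀ h0.ne'
    nlinarith [sq_nonneg (l - 1), inv_pos.2 h0]
  generalize hA : l - 1 = a at *
  generalize hB : 1 - l⁻¹ = b at *
  set K := (a + b) * (2 * N) with hK
  set T := 2 * N + K / (ε * b ^ 2) with hT
  obtain ⟨R, hR⟩ := ((isCompact_closedBall (0 : ℝ × ℝ) T).image h.symm.continuous).isBounded.exists_norm_le
  refine ⟨max R 1, by positivity, fun x hx y hy z hz => ?_⟩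
  have hxT : T < |(h x).1| + |(h x).2| := by
    by_contra! hcon
    have : ‖x‖ ≤ R := by
      refine hR x ⟨h x, ?_, by simp⟩
      rw [mem_closedBall_zero_iff, Prod.norm_def, Real.norm_eq_abs, Real.norm_eq_abs]
      exact max_le (by linarith [abs_nonneg (h x).2]) (by linarith [abs_nonneg (h x).1])
    linarith [le_max_left R 1]
  have hd1 := abs_sub_abs_le_abs_sub (h x).1 (h y).1
  have hd2 := abs_sub_abs_le_abs_sub (h x).2 (h y).2
  have hy1 := hM1 y hy
  have hz1 := hM1 z hz
  have hV : |Vd f (modelU h) x y - Vd f (modelU h) x z| ≤ K := by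
    rw [model_V hl hh, model_V hl hh, hA, hB]
    have e1 : |(|(h x).1 - (h y).1| - |(h x).1 - (h z).1|)| ≤ 2 * N := by
      refine (abs_abs_sub_abs_le _ _).trans ?_
      rw [sub_sub_sub_cancel_left]
      refine (abs_sub _ _).trans ?_
      linarith
    have e2 : |(|(h x).2 - (h y).2| - |(h x).2 - (h z).2|)| ≤ 2 * N := by
      refine (abs_abs_sub_abs_le _ _).trans ?_
      rw [sub_sub_sub_cancel_left]
      refine (abs_sub _ _).trans ?_
      linarith
    rw [abs_le] at *
    rw [hK]
    constructor <;> nlinarith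
  have hW : K / ε < Wd f (modelU h) x y := by
    rw [model_W hl hh, hA, hB]
    have e1 : b ^ 2 ≤ a ^ 2 := pow_le_pow_left₀ hb.le hba 2
    have e2 := mul_le_mul_of_nonneg_right e1 (abs_nonneg ((h x).1 - (h y).1))
    have e3 : K / (ε * b ^ 2) < |(h x).1 - (h y).1| + |(h x).2 - (h y).2| := by linarith
    have e4 := mul_lt_mul_of_pos_left e3 (pow_pos hb 2)
    have e5 : b ^ 2 * (K / (ε * b ^ 2)) = K / ε := by field_simp
    linarith
  have hK0 : 0 ≤ K := by positivity
  have hW0 : 0 < Wd f (modelU h) x y := lt_of_le_of_lt (by positivity) hW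
  rw [div_lt_iff₀ hW0]
  rw [div_lt_iff₀ hε] at hW
  linarith

theorem sigma_exists (c : ℝ) : ∃ σ : ℝ → ℝ, IsOpenEmbedding σ ∧ c ∈ range σ ∧ ∀ t, |σ t - c| ≤ 1 / 2 := by
  have h1 : IsOpenEmbedding Real.arctan := by
    refine ⟨Real.arctan_strictMono.isEmbedding_of_ordConnected ?_, ?_⟩
    · rw [Real.range_arctan]; exact ordConnected_Ioo
    · rw [Real.range_arctan]; exact isOpen_Ioo
  have h2 := (Homeomorph.addLeft c).isOpenEmbedding.comp
    ((Homeomorph.mulRight₀ (1 / 4 : ℝ) (by norm_num)).isOpenEmbedding.comp h1)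
  refine ⟨fun t => c + Real.arctan t * (1 / 4), h2, ⟨0, by simp⟩, fun t => ?_⟩
  have h1 := Real.arctan_lt_pi_div_two t
  have h2 := Real.neg_pi_div_two_lt_arctan t
  have h3 := Real.pi_lt_four
  simp only [add_sub_cancel_left]
  rw [abs_le]; constructor <;> linarith

theorem model_ns (hl : 1 < l) (hh : ∀ z : ℝ × ℝ, h (f z) = (l * (h z).1, l⁻¹ * (h z).2)) :
    NoSingularities f (modelU h) := by
  intro p
  obtain ⟨σ, hσ, ⟨s0, hs0⟩, hσb⟩ := sigma_exists (h p).1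
  obtain ⟨τ, hτ, ⟨t0, ht0⟩, hτb⟩ := sigma_exists (h p).2
  have hC : ∀ x, Ck f (modelU h) 1 x = {y | (h x).1 = (h y).1 ∧ |(h x).2 - (h y).2| ≤ 1} := by
    intro x
    have e : Sk f (modelU h) 1 x = {y | (h x).1 = (h y).1 ∧ |(h x).2 - (h y).2| ≤ 1} := by
      ext y; exact model_s hl hh x y 1
    rw [Ck, e]
    refine IsPreconnected.connectedComponentIn ?_ (by simp)
    refine preconn_of_convex (h := h) ({(h x).1} ×ˢ Icc ((h x).2 - 1) ((h x).2 + 1))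
      (isPreconnected_singleton.prod isPreconnected_Icc) fun y => ?_
    simp only [mem_ofPred_eq, mem_prod, mem_singleton_iff, mem_Icc, abs_le]
    constructor
    · rintro ⟨h1, h2, h3⟩; exact ⟨h1.symm, by linarith, by linarith⟩
    · rintro ⟨h1, h2, h3⟩; exact ⟨h1.symm, by linarith, by linarith⟩
  have hD : ∀ x, Dk f (modelU h) 1 x = {y | (h x).2 = (h y).2 ∧ |(h x).1 - (h y).1| ≤ 1} := by
    intro x
    have e : Uk f (modelU h) 1 x = {y | (h x).2 = (h y).2 ∧ |(h x).1 - (h y).1| ≤ 1} := by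
      ext y; exact model_u hl hh x y 1
    rw [Dk, e]
    refine IsPreconnected.connectedComponentIn ?_ (by simp)
    refine preconn_of_convex (h := h) (Icc ((h x).1 - 1) ((h x).1 + 1) ×ˢ {(h x).2})
      (isPreconnected_Icc.prod isPreconnected_singleton) fun y => ?_
    simp only [mem_ofPred_eq, mem_prod, mem_singleton_iff, mem_Icc, abs_le]
    constructor
    · rintro ⟨h1, h2, h3⟩; exact ⟨⟨by linarith, by linarith⟩, h1.symm⟩
    · rintro ⟨⟨h2, h3⟩, h1⟩; exact ⟨h1.symm, by linarith, by linarith⟩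
  refine ⟨fun q => h.symm (σ q.1, τ q.2), 1, one_pos, ?_, ?_, ?_, ⟨(s0, t0), by simp [hs0, ht0]⟩, ?_⟩
  · have := hσ.continuous
    have := hτ.continuous
    fun_prop
  · intro a b hab
    have := h.symm.injective hab
    rw [Prod.mk.injEq] at this
    exact Prod.ext (hσ.injective this.1) (hτ.injective this.2)
  · exact h.symm.isOpenMap.comp (hσ.isOpenMap.prodMap hτ.isOpenMap)
  · intro a b
    rw [hC, hD]
    constructor
    · ext y
      constructor
      · rintro ⟨⟨a', b'⟩, rfl, rfl⟩
        refine ⟨?_, mem_range_self _⟩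
        have h1 := abs_le.1 (hτb b)
        have h2 := abs_le.1 (hτb b')
        simp only [mem_ofPred_eq, Homeomorph.apply_symm_apply, true_and]
        rw [abs_le]; constructor <;> linarith
      · rintro ⟨hy, ⟨a', b'⟩, rfl⟩
        simp only [mem_ofPred_eq, Homeomorph.apply_symm_apply] at hy
        exact ⟨(a', b'), (hσ.injective hy.1).symm, rfl⟩
    · ext y
      constructor
      · rintro ⟨⟨a', b'⟩, rfl, rfl⟩
        refine ⟨?_, mem_range_self _⟩
        have h1 := abs_le.1 (hσb a)
        have h2 := abs_le.1 (hσb a')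
        simp only [mem_ofPred_eq, Homeomorph.apply_symm_apply, true_and]
        rw [abs_le]; constructor <;> linarith
      · rintro ⟨hy, ⟨a', b'⟩, rfl⟩
        simp only [mem_ofPred_eq, Homeomorph.apply_symm_apply] at hy
        exact ⟨(a', b'), (hτ.injective hy.1).symm, rfl⟩

theorem model_quad (hl : 1 < l) (hh : ∀ z : ℝ × ℝ, h (f z) = (l * (h z).1, l⁻¹ * (h z).2)) :
    QuadrantsInvariant f (modelU h) (h.symm (0, 0)) := by
  have h0 : 0 < l := by linarith
  have hWs : ∀ x, x ∈ Ws f (modelU h) (h.symm (0, 0)) ↔ (h x).1 = 0 := by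
    intro x
    constructor
    · rintro ⟨K, -, hK⟩
      rw [model_s hl hh] at hK
      simpa using hK.1.symm
    · intro hx
      refine ⟨|(h x).2| + 1, by positivity, ?_⟩
      rw [model_s hl hh]
      simp [hx]
  have hWu : ∀ x, x ∈ Wu f (modelU h) (h.symm (0, 0)) ↔ (h x).2 = 0 := by
    intro x
    constructor
    · rintro ⟨K, -, hK⟩
      rw [model_u hl hh] at hK
      simpa using hK.1.symm
    · intro hx
      refine ⟨|(h x).1| + 1, by positivity, ?_⟩
      rw [model_u hl hh]
      simp [hx]
  have hc : ∀ x, x ∈ (Ws f (modelU h) (h.symm (0, 0)) ∪ Wu f (modelU h) (h.symm (0, 0)))ᶜ ↔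
      (h x).1 ≠ 0 ∧ (h x).2 ≠ 0 := fun x => by
    simp only [mem_compl_iff, mem_union, hWs, hWu, not_or]
  intro q hq
  have hq' := (hc q).1 hq
  have hcomp : connectedComponentIn
      (Ws f (modelU h) (h.symm (0, 0)) ∪ Wu f (modelU h) (h.symm (0, 0)))ᶜ q =
      {x | 0 < (h x).1 * (h q).1 ∧ 0 < (h x).2 * (h q).2} := by
    apply Subset.antisymm
    · intro x hx
      constructor
      · exact pos_of_preconn (φ := fun x => (h x).1 * (h q).1) isPreconnected_connectedComponentIn
          (by fun_prop) (fun y hy => mul_ne_zero ((hc y).1 (connectedComponentIn_subset _ _ hy)).1 hq'.1)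
          (mem_connectedComponentIn hq) hx (mul_self_pos.2 hq'.1)
      · exact pos_of_preconn (φ := fun x => (h x).2 * (h q).2) isPreconnected_connectedComponentIn
          (by fun_prop) (fun y hy => mul_ne_zero ((hc y).1 (connectedComponentIn_subset _ _ hy)).2 hq'.2)
          (mem_connectedComponentIn hq) hx (mul_self_pos.2 hq'.2)
    · refine IsPreconnected.subset_connectedComponentIn ?_
        ⟨mul_self_pos.2 hq'.1, mul_self_pos.2 hq'.2⟩ ?_
      · have e : ∀ c : ℝ, IsPreconnected {t : ℝ | 0 < t * c} := fun c => by
          refine Convex.isPreconnected ?_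
          intro a ha b hb s t hs ht hst
          simp only [mem_ofPred_eq, smul_eq_mul] at *
          rcases hs.eq_or_lt with rfl | hs
          · simp only [zero_add] at hst; subst hst; simpa using hb
          · have := mul_pos hs ha
            have := mul_nonneg ht hb.le
            nlinarith
        exact preconn_of_convex (h := h) ({t : ℝ | 0 < t * (h q).1} ×ˢ {t : ℝ | 0 < t * (h q).2})
          ((e _).prod (e _)) fun y => Iff.rfl
      · intro x hx
        exact (hc x).2 ⟨left_ne_zero_of_mul hx.1.ne', left_ne_zero_of_mul hx.2.ne'⟩
  rw [hcomp]
  have hiff : ∀ x, (0 < (h (f x)).1 * (h q).1 ∧ 0 < (h (f x)).2 * (h q).2) ↔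
      (0 < (h x).1 * (h q).1 ∧ 0 < (h x).2 * (h q).2) := fun x => by
    rw [hh]
    simp only [mul_assoc]
    rw [mul_pos_iff_of_pos_left h0, mul_pos_iff_of_pos_left (inv_pos.2 h0)]
  ext x
  constructor
  · rintro ⟨y, hy, rfl⟩; exact (hiff y).2 hy
  · intro hx
    refine ⟨f.symm x, ?_, by simp⟩
    apply (hiff _).1
    simpa using hx

theorem forward (hl : 1 < l) (hh : ∀ z : ℝ × ℝ, h (f z) = (l * (h z).1, l⁻¹ * (h z).2)) :
    ∃ p : ℝ × ℝ, f p = p ∧ ∃ U : ℝ × ℝ → ℝ × ℝ → ℝ,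
      IsLyapunovMetric f U ∧ BothSigns f U ∧ CondHP f U ∧
      NoSingularities f U ∧ QuadrantsInvariant f U p :=
  ⟨h.symm (0, 0), by apply h.injective; rw [hh]; simp, modelU h, model_lyap hl hh, model_both hl hh,
    model_HP hl hh, model_ns hl hh, model_quad hl hh⟩

end Forward

end Helpers

/-- a homeomorphism of the plane is topologically conjugate to a
linear hyperbolic automorphism if and only if it has a fixed point `p` and
admits a Lyapunov metric function satisfying the both-signs condition and
condition HP, with no singularities and `f`-invariant quadrants. -/
theorem conjugate_to_linear_hyperbolic_iff
    (f : Equiv.Perm (ℝ × ℝ)) (hf : Continuous f) (hf' : Continuous f.symm) :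
    (∃ l : ℝ, 1 < l ∧ ∃ h : ℝ × ℝ ≃ₜ ℝ × ℝ,
      ∀ z : ℝ × ℝ, h (f z) = (l * (h z).1, l⁻¹ * (h z).2)) ↔
    (∃ p : ℝ × ℝ, f p = p ∧ ∃ U : ℝ × ℝ → ℝ × ℝ → ℝ,
      IsLyapunovMetric f U ∧ BothSigns f U ∧ CondHP f U ∧
      NoSingularities f U ∧ QuadrantsInvariant f U p) := by
  constructor
  · rintro ⟨l, hl, h, hh⟩
    exact forward hl hh
  · rintro ⟨p, hp, U, hU, hB, hHP, hns, hQ⟩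
    exact backward hU hB hHP hns hf hf' hp hQ
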